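/- arXiv:math/0511642 — 5 statements merged into one kernel-verified Lean document; each statement's English description precedes it below -/
import Mathlib

section
/- Let A be a finite-dimensional associative unital algebra over a field k. Then A is an Azumaya algebra over its center Z(A) if and only if for every surjective homomorphism π : A → B of unital k-algebras, π maps the center Z(A) onto the center Z(B). -/
set_option synthInstance.maxHeartbeats 1000000
set_option maxHeartbeats 1000000

noncomputable section Azumaya

open TensorProduct

variable (k A : Type) [Field k] [Ring A] [Algebra k A]

/-- The natural map `A ⊗_{Z(A)} A^op → End_{Z(A)}(A)`, `a ⊗ b ↦ (x ↦ a x b)`. -/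
def azumayaMap :
    TensorProduct (Subalgebra.center k A) A Aᵐᵒᵖ →ₗ[Subalgebra.center k A]
      Module.End (Subalgebra.center k A) A :=
  TensorProduct.lift (LinearMap.mk₂ (Subalgebra.center k A)
    (fun a bop =>
      { toFun := fun x => a * x * bop.unop
        map_add' := by intro x y; simp [mul_add, add_mul]
        map_smul' := by
          intro c x
          have hc := Subalgebra.mem_center_iff.mp c.2
          show a * ((c : A) * x) * _ = (c : A) * (a * x * _)
          rw [← mul_assoc, hc a, mul_assoc, mul_assoc, mul_assoc] })
    (by intro a a' bop; ext x; show (a + a') * x * _ = _; simp [add_mul])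
    (by
      intro c a bop; ext x
      have hc := Subalgebra.mem_center_iff.mp c.2
      show ((c : A) * a) * x * _ = (c : A) * (a * x * _)
      rw [mul_assoc, mul_assoc, mul_assoc])
    (by
      intro a bop bop'; ext x
      show a * x * (bop + bop').unop = _
      simp [mul_add])
    (by
      intro c a bop; ext x
      have hc := Subalgebra.mem_center_iff.mp c.2
      show a * x * (MulOpposite.unop (c • bop)) = (c : A) * (a * x * bop.unop)
      have h1 : MulOpposite.unop (c • bop) = (c : A) * bop.unop := rfl
      rw [h1, ← hc bop.unop, ← mul_assoc, hc (a * x * bop.unop)]))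

/-- `A` is an Azumaya algebra over its center `Z(A)`: it is a faithful finitely generated
projective `Z(A)`-module and the natural map `A ⊗_{Z(A)} A^op → End_{Z(A)}(A)` is an
isomorphism. -/
def IsAzumayaOverCenter : Prop :=
  FaithfulSMul (Subalgebra.center k A) A ∧
  Module.Finite (Subalgebra.center k A) A ∧
  Module.Projective (Subalgebra.center k A) A ∧
  Function.Bijective (azumayaMap k A)

end Azumaya

section CenterAlgebra

instance centerAlgebra (R A : Type*) [CommRing R] [Ring A] [Algebra R A] :
    Algebra (Subalgebra.center R A) A where
  algebraMap := (Subalgebra.center R A).val.toRingHom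
  commutes' c x := ((Subalgebra.mem_center_iff.mp c.2) x).symm
  smul_def' _ _ := rfl

theorem algebraMap_center_apply {R A : Type*} [CommRing R] [Ring A] [Algebra R A]
    (c : Subalgebra.center R A) : algebraMap (Subalgebra.center R A) A c = c :=
  rfl

end CenterAlgebra

section CentralSimple

open TensorProduct MulOpposite

/-- An element `e` of the enveloping algebra on which left multiplication by `t` depends only on
the value `t • 1 ∈ A`; equivalently, `(a ⊗ 1) * e = (1 ⊗ a) * e` for all `a`. -/
def IsCasimir (R : Type*) {A : Type*} [CommRing R] [Ring A] [Algebra R A]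
    (e : A ⊗[R] Aᵐᵒᵖ) : Prop :=
  ∀ t : A ⊗[R] Aᵐᵒᵖ, t * e = (AlgHom.mulLeftRight R A t 1 ⊗ₜ 1) * e

theorem mulLeftRight_bijective_of_central_simple (F S : Type*) [Field F] [Ring S] [Algebra F S]
    [Algebra.IsCentral F S] [IsSimpleRing S] [FiniteDimensional F S] :
    Function.Bijective (AlgHom.mulLeftRight F S) := by
  have hsurj : Function.Surjective (AlgHom.mulLeftRight F S) := by
    let : Module (S ⊗[F] Sᵐᵒᵖ) S := Module.compHom S (AlgHom.mulLeftRight F S).toRingHom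
    have hsmul : ∀ (t : S ⊗[F] Sᵐᵒᵖ) (x : S), t • x = AlgHom.mulLeftRight F S t x :=
      fun _ _ => rfl
    have : IsSimpleModule (S ⊗[F] Sᵐᵒᵖ) S := by
      have hI := (isSimpleRing_iff_isTwoSided_imp (R := S)).mp inferInstance
      rw [isSimpleModule_iff]
      refine { exists_pair_ne := ⟨⊥, ⊤, bot_ne_top⟩, eq_bot_or_eq_top := fun N => ?_ }
      let I : Ideal S :=
        { carrier := N
          add_mem' := N.add_mem
          zero_mem' := N.zero_mem
          smul_mem' := fun c x hx => by
            have := N.smul_mem (c ⊗ₜ[F] (1 : Sᵐᵒᵖ)) hx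
            simpa [hsmul] using this }
      have hI2 : I.IsTwoSided := ⟨fun {a} b ha => by
        have := N.smul_mem ((1 : S) ⊗ₜ[F] op b) ha
        simp only [hsmul, AlgHom.mulLeftRight_apply, one_mul, unop_op] at this
        exact this⟩
      rcases hI.2 I hI2 with h | h
      · left
        ext x
        have : x ∈ I ↔ x ∈ (⊥ : Ideal S) := by rw [h]
        exact this
      · right
        ext x
        have : x ∈ I ↔ x ∈ (⊤ : Ideal S) := by rw [h]
        exact this
    intro g
    have hlin : ∀ (φ : Module.End (S ⊗[F] Sᵐᵒᵖ) S), ∃ c : F, ∀ x, φ x = c • x := by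
      intro φ
      have h1 : ∀ a x b : S, φ (a * x * b) = a * φ x * b := by
        intro a x b
        have := φ.map_smul (a ⊗ₜ[F] op b) x
        simpa [hsmul] using this
      have hc : φ 1 ∈ Subalgebra.center F S := by
        rw [Subalgebra.mem_center_iff]
        intro b
        have h2 := h1 1 1 b
        have h3 := h1 b 1 1
        simp only [one_mul, mul_one] at h2 h3
        rw [← h2, ← h3]
      obtain ⟨c, hc⟩ := Algebra.mem_bot.mp (Algebra.IsCentral.out hc)
      refine ⟨c, fun x => ?_⟩
      have h3 := h1 1 1 x
      simp only [one_mul] at h3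
      rw [h3, ← hc, Algebra.smul_def]
    let f : Module.End (Module.End (S ⊗[F] Sᵐᵒᵖ) S) S :=
      { toFun := g
        map_add' := g.map_add
        map_smul' := fun φ x => by
          obtain ⟨c, hc⟩ := hlin φ
          simp [hc] }
    classical
    let b := Module.finBasis F S
    obtain ⟨t, ht⟩ := jacobson_density f (Finset.univ.image b)
    refine ⟨t, b.ext fun i => ?_⟩
    exact (ht (b i) (Finset.mem_image_of_mem _ (Finset.mem_univ i))).symm
  refine ⟨?_, hsurj⟩
  refine (LinearMap.injective_iff_surjective_of_finrank_eq_finrank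
    (f := (AlgHom.mulLeftRight F S).toLinearMap) ?_).mpr hsurj
  rw [Module.finrank_tensorProduct, Module.finrank_linearMap,
    (opLinearEquiv F : S ≃ₗ[F] Sᵐᵒᵖ).finrank_eq]

theorem isSimpleRing_moduleEnd (F V : Type*) [Field F] [AddCommGroup V] [Module F V]
    [FiniteDimensional F V] [Nontrivial V] : IsSimpleRing (Module.End F V) := by
  have : Nonempty (Fin (Module.finrank F V)) := ⟨⟨0, Module.finrank_pos⟩⟩
  exact IsSimpleRing.of_ringEquiv (algEquivMatrix (Module.finBasis F V)).symm.toRingEquiv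
    inferInstance

theorem exists_isCasimir_of_central_simple (F S : Type*) [Field F] [Ring S] [Algebra F S]
    [Algebra.IsCentral F S] [IsSimpleRing S] [FiniteDimensional F S] :
    IsSimpleRing (S ⊗[F] Sᵐᵒᵖ) ∧
      ∃ e : S ⊗[F] Sᵐᵒᵖ, AlgHom.mulLeftRight F S e 1 = 1 ∧ IsCasimir F e := by
  have hbij := mulLeftRight_bijective_of_central_simple F S
  refine ⟨IsSimpleRing.of_ringEquiv
    (AlgEquiv.ofBijective _ hbij).symm.toRingEquiv (isSimpleRing_moduleEnd F S), ?_⟩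
  obtain ⟨f, hf⟩ := Module.Projective.exists_dual_eq_one F (one_ne_zero (α := S))
  obtain ⟨e, he⟩ := hbij.2 (f.smulRight (1 : S))
  have he' : ∀ x, AlgHom.mulLeftRight F S e x = f x • 1 := fun x => by rw [he]; simp
  refine ⟨e, by rw [he', hf, one_smul], fun t => hbij.1 ?_⟩
  ext x
  simp [he']

theorem exists_isCasimir_of_simple (Z S : Type*) [CommRing Z] [Ring S] [Algebra Z S]
    [IsSimpleRing S] [Module.Finite Z S]
    (hc : ∀ c ∈ Subring.center S, ∃ z, algebraMap Z S z = c) :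
    IsSimpleRing (S ⊗[Z] Sᵐᵒᵖ) ∧
      ∃ e : S ⊗[Z] Sᵐᵒᵖ, AlgHom.mulLeftRight Z S e 1 = 1 ∧ IsCasimir Z e := by
  have hF : IsField (Subalgebra.center Z S) := IsSimpleRing.isField_center S
  have hsC : Function.Surjective (algebraMap Z (Subalgebra.center Z S)) := fun c => by
    obtain ⟨z, hz⟩ := hc c c.2
    exact ⟨z, Subtype.ext hz⟩
  obtain ⟨F, _, _, _, _, hs⟩ : ∃ (F : Type _) (_ : Field F) (_ : Algebra Z F) (_ : Algebra F S),
      IsScalarTower Z F S ∧ Function.Surjective (algebraMap Z F) :=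
    ⟨Subalgebra.center Z S, hF.toField, (inferInstance : Algebra Z (Subalgebra.center Z S)),
      (inferInstance : Algebra (Subalgebra.center Z S) S),
      (inferInstance : IsScalarTower Z (Subalgebra.center Z S) S), hsC⟩
  have : Algebra.IsCentral F S := ⟨fun x hx => by
    rw [Subalgebra.mem_center_iff] at hx
    obtain ⟨z, hz⟩ := hc x (Subring.mem_center_iff.mpr hx)
    exact Algebra.mem_bot.mpr ⟨algebraMap Z F z, by
      rw [← hz, ← IsScalarTower.algebraMap_apply]⟩⟩
  have : Module.Finite F S := Module.Finite.of_restrictScalars_finite Z _ _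
  obtain ⟨h1, e, he1, he⟩ := exists_isCasimir_of_central_simple F S
  have : CompatibleSMul Z F S Sᵐᵒᵖ := CompatibleSMul.of_algebraMap_surjective S Sᵐᵒᵖ hs
  let E : S ⊗[F] Sᵐᵒᵖ ≃ₐ[Z] S ⊗[Z] Sᵐᵒᵖ :=
    Algebra.TensorProduct.equivOfCompatibleSMul Z F Z S Sᵐᵒᵖ
  have hE : ∀ (t) (x : S), AlgHom.mulLeftRight Z S (E t) x =
      AlgHom.mulLeftRight F S t x := by
    intro t x
    induction t with
    | zero => simp
    | add a b ha hb => simp [ha, hb]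
    | tmul a b =>
      have : E (a ⊗ₜ b) = a ⊗ₜ b := rfl
      simp [this]
  refine ⟨IsSimpleRing.of_ringEquiv E.toRingEquiv h1, E e, by rw [hE, he1], fun t => ?_⟩
  obtain ⟨t, rfl⟩ := E.surjective t
  rw [← map_mul, he t, map_mul, hE]
  rfl

end CentralSimple

section EnvelopingAlgebra

open TensorProduct MulOpposite

variable {Z A S : Type*} [CommRing Z] [Ring A] [Algebra Z A] [Ring S] [Algebra Z S]

/-- The homomorphism of enveloping algebras induced by an algebra homomorphism. -/
noncomputable def envMap (f : A →ₐ[Z] S) : A ⊗[Z] Aᵐᵒᵖ →ₐ[Z] S ⊗[Z] Sᵐᵒᵖ :=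
  Algebra.TensorProduct.map f (AlgHom.op f)

@[simp]
theorem envMap_tmul (f : A →ₐ[Z] S) (a : A) (b : Aᵐᵒᵖ) :
    envMap f (a ⊗ₜ b) = f a ⊗ₜ op (f b.unop) :=
  rfl

theorem op_surjective_of_surjective {f : A →ₐ[Z] S} (hf : Function.Surjective f) :
    Function.Surjective (AlgHom.op f) := fun b => by
  obtain ⟨a, ha⟩ := hf b.unop
  exact ⟨op a, by simp [ha]⟩

theorem envMap_surjective {f : A →ₐ[Z] S} (hf : Function.Surjective f) :
    Function.Surjective (envMap f) :=
  TensorProduct.map_surjective hf (op_surjective_of_surjective hf)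

theorem mulLeftRight_envMap (f : A →ₐ[Z] S) (t : A ⊗[Z] Aᵐᵒᵖ) (x : A) :
    AlgHom.mulLeftRight Z S (envMap f t) (f x) = f (AlgHom.mulLeftRight Z A t x) := by
  induction t with
  | zero => simp
  | add a b ha hb => simp [ha, hb]
  | tmul a b => simp

theorem mem_of_envMap_eq_zero {f : A →ₐ[Z] S} (hf : Function.Surjective f)
    (P : Submodule Z (A ⊗[Z] Aᵐᵒᵖ))
    (hl : ∀ a b, f a = 0 → a ⊗ₜ b ∈ P) (hr : ∀ a b, f (unop b) = 0 → a ⊗ₜ b ∈ P)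
    {t : A ⊗[Z] Aᵐᵒᵖ} (ht : envMap f t = 0) : t ∈ P := by
  have hk := TensorProduct.map_ker
    (LinearMap.exact_subtype_ker_map f.toLinearMap)
    hf (LinearMap.exact_subtype_ker_map (AlgHom.op f).toLinearMap)
    (op_surjective_of_surjective hf)
  have ht' : t ∈ LinearMap.ker (TensorProduct.map f.toLinearMap (AlgHom.op f).toLinearMap) := ht
  rw [hk] at ht'
  revert ht'
  suffices h : _ ⊔ _ ≤ P from fun ht' => h ht'
  refine sup_le ?_ ?_
  · rintro _ ⟨u, rfl⟩
    induction u with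
    | zero => simp
    | add a b ha hb => rw [map_add]; exact P.add_mem ha hb
    | tmul a b =>
      exact hr a b (congrArg unop (LinearMap.mem_ker.mp b.2))
  · rintro _ ⟨u, rfl⟩
    induction u with
    | zero => simp
    | add a b ha hb => rw [map_add]; exact P.add_mem ha hb
    | tmul a b => exact hl a b (LinearMap.mem_ker.mp a.2)

theorem mulLeftRight_mem_of_isTwoSided (I : Ideal A) [I.IsTwoSided] (t : A ⊗[Z] Aᵐᵒᵖ) {x : A}
    (hx : x ∈ I) : AlgHom.mulLeftRight Z A t x ∈ I := by
  induction t with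
  | zero => simp
  | add a b ha hb => rw [map_add]; exact I.add_mem ha hb
  | tmul a b =>
    rw [AlgHom.mulLeftRight_apply]
    exact I.mul_mem_right _ (I.mul_mem_left _ hx)

theorem IsCasimir.mul_right {e : A ⊗[Z] Aᵐᵒᵖ} (he : IsCasimir Z e) (s : A ⊗[Z] Aᵐᵒᵖ) :
    IsCasimir Z (e * s) := fun t => by
  rw [← mul_assoc, he t, mul_assoc]

/-- The two-sided ideal of the enveloping algebra generated by the Casimir elements. -/
def casimirIdeal (Z A : Type*) [CommRing Z] [Ring A] [Algebra Z A] : Ideal (A ⊗[Z] Aᵐᵒᵖ) :=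
  Ideal.span {e | IsCasimir Z e}

instance : (casimirIdeal Z A).IsTwoSided where
  mul_mem_of_left {a} b ha := by
    refine Submodule.span_induction (p := fun a _ => a * b ∈ casimirIdeal Z A) ?_ ?_ ?_ ?_ ha
    · exact fun x hx => Ideal.subset_span (IsCasimir.mul_right hx b)
    · simp
    · intro x y _ _ hx hy
      rw [add_mul]
      exact Ideal.add_mem _ hx hy
    · intro c x _ hx
      rw [smul_eq_mul, mul_assoc]
      exact Ideal.mul_mem_left _ _ hx

/-- A two-sided ideal whose image in a simple quotient of the enveloping algebra is nonzero
maps onto that quotient. -/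
theorem exists_mem_envMap_eq_one [IsSimpleRing (S ⊗[Z] Sᵐᵒᵖ)] {f : A →ₐ[Z] S}
    (hf : Function.Surjective f) (K : Ideal (A ⊗[Z] Aᵐᵒᵖ)) [K.IsTwoSided]
    {e : A ⊗[Z] Aᵐᵒᵖ} (he : e ∈ K) (he0 : envMap f e ≠ 0) : ∃ t ∈ K, envMap f t = 1 := by
  have hs := envMap_surjective hf
  have : RingHomSurjective (envMap f).toRingHom := ⟨hs⟩
  have hmap : (K.map (envMap f).toRingHom).IsTwoSided := inferInstance
  rcases (isSimpleRing_iff_isTwoSided_imp.mp ‹_›).2 _ hmap with h | h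
  · have hm := Ideal.mem_map_of_mem (envMap f).toRingHom he
    rw [h] at hm
    exact absurd hm he0
  · have h1 : (1 : S ⊗[Z] Sᵐᵒᵖ) ∈ K.map (envMap f).toRingHom := by rw [h]; trivial
    exact (Ideal.mem_map_iff_of_surjective (envMap f).toRingHom hs).mp h1

end EnvelopingAlgebra

section Simplicity

open TensorProduct MulOpposite

theorem isSimpleRing_of_isSemisimpleRing {B : Type*} [Ring B] [IsSemisimpleRing B] [Nontrivial B]
    (h : ∀ e : B, IsIdempotentElem e → (∀ b, b * e = e * b) → e = 0 ∨ e = 1) :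
    IsSimpleRing B := by
  refine isSimpleRing_iff_isTwoSided_imp.mpr ⟨inferInstance, fun I hI => ?_⟩
  obtain ⟨e, he, hIe⟩ := IsSemisimpleRing.ideal_eq_span_idempotent I
  let J : Ideal Bᵐᵒᵖ :=
    { carrier := {x | unop x ∈ I}
      add_mem' := fun ha hb => I.add_mem ha hb
      zero_mem' := I.zero_mem
      smul_mem' := fun c x hx => I.mul_mem_right c.unop hx }
  obtain ⟨f, hf, hJf⟩ := IsSemisimpleRing.ideal_eq_span_idempotent J
  have heI : e ∈ I := by rw [hIe]; exact Ideal.mem_span_singleton_self e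
  have hfI : unop f ∈ I := by
    have : f ∈ J := by rw [hJf]; exact Ideal.mem_span_singleton_self f
    exact this
  have hre : ∀ x ∈ I, x * e = x := by
    intro x hx
    rw [hIe, Ideal.mem_span_singleton'] at hx
    obtain ⟨a, rfl⟩ := hx
    rw [mul_assoc, he.eq]
  have hlf : ∀ x ∈ I, unop f * x = x := by
    intro x hx
    have : op x ∈ J := hx
    rw [hJf, Ideal.mem_span_singleton'] at this
    obtain ⟨a, ha⟩ := this
    have h1 : op x * f = op x := by rw [← ha, mul_assoc, hf.eq]
    simpa using congrArg unop h1
  have hef : unop f = e := (hre _ hfI).symm.trans (hlf _ heI)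
  rw [hef] at hlf
  have hc : ∀ b, b * e = e * b := fun b => by
    rw [← hlf _ (I.mul_mem_left b heI), ← mul_assoc, hre _ (I.mul_mem_right b heI)]
  rcases h e he hc with h0 | h1
  · left
    rw [hIe, h0]
    simp
  · right
    exact I.eq_top_iff_one.mpr (h1 ▸ heI)

theorem isSimpleRing_of_center (Z B : Type*) [CommRing Z] [Ring B] [Algebra Z B]
    [Module.Finite Z B] [IsArtinianRing B] [Nontrivial B]
    (hunit : ∀ z : Z, algebraMap Z B z = 0 ∨ IsUnit (algebraMap Z B z))
    (hcent : ∀ I : Ideal B, I.IsTwoSided → ∀ b, (∀ c, b * c - c * b ∈ I) →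
      ∃ z : Z, b - algebraMap Z B z ∈ I) :
    IsSimpleRing B := by
  set R := Ring.jacobson B with hR
  have hRtop : R ≠ ⊤ := by
    intro h
    obtain ⟨n, hn⟩ := IsSemiprimaryRing.isNilpotent (R := B)
    rw [← hR, h, Ideal.top_pow] at hn
    exact top_ne_bot hn
  have : Nontrivial (B ⧸ R) := Ideal.Quotient.nontrivial_iff.mpr hRtop
  have : IsSemisimpleRing (B ⧸ R) := IsSemiprimaryRing.isSemisimpleRing
  let f : B →ₐ[Z] B ⧸ R := Ideal.Quotient.mkₐ Z R
  have hf : Function.Surjective f := Ideal.Quotient.mkₐ_surjective Z R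
  have hf0 : ∀ x, f x = 0 ↔ x ∈ R := fun x => Ideal.Quotient.eq_zero_iff_mem
  have hcS : ∀ c : B ⧸ R, (∀ b, b * c = c * b) → ∃ z : Z, algebraMap Z (B ⧸ R) z = c := by
    intro c hc
    obtain ⟨b, rfl⟩ := hf c
    obtain ⟨z, hz⟩ := hcent R inferInstance b fun c => by
      rw [← hf0, map_sub, map_mul, map_mul, hc, sub_self]
    refine ⟨z, ?_⟩
    rw [← hf0, map_sub, AlgHom.commutes, sub_eq_zero] at hz
    exact hz.symm
  have hS : IsSimpleRing (B ⧸ R) := by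
    refine isSimpleRing_of_isSemisimpleRing fun e he hc => ?_
    obtain ⟨z, rfl⟩ := hcS e hc
    rcases hunit z with h | h
    · left
      rw [← f.commutes, h, map_zero]
    · right
      have h2 := h.map f
      rw [f.commutes] at h2
      exact (IsIdempotentElem.iff_eq_one_of_isUnit h2).mp he
  obtain ⟨hSe, e, he1, he⟩ := exists_isCasimir_of_simple Z (B ⧸ R) fun c hc =>
    hcS c (Subring.mem_center_iff.mp hc)
  obtain ⟨e, rfl⟩ := envMap_surjective hf e
  let K : Ideal (B ⊗[Z] Bᵐᵒᵖ) :=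
    { carrier := {t | ∀ r ∈ R, AlgHom.mulLeftRight Z B t r ∈ R * R}
      add_mem' := fun ha hb r hr => by
        rw [map_add]
        exact Ideal.add_mem _ (ha r hr) (hb r hr)
      zero_mem' := fun r _ => by simp
      smul_mem' := fun c t ht r hr => by
        rw [smul_eq_mul, map_mul]
        exact mulLeftRight_mem_of_isTwoSided _ c (ht r hr) }
  have hK2 : K.IsTwoSided := ⟨fun {t} s ht r hr => by
    rw [map_mul]
    exact ht _ (mulLeftRight_mem_of_isTwoSided _ s hr)⟩
  have hker : ∀ t, envMap f t = 0 → t ∈ K := fun t ht =>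
    mem_of_envMap_eq_zero hf (K.restrictScalars Z)
      (fun a b ha r hr => by
        rw [AlgHom.mulLeftRight_apply]
        exact Ideal.mul_mem_right _ _ (Ideal.mul_mem_mul ((hf0 a).mp ha) hr))
      (fun a b hb r hr => by
        rw [AlgHom.mulLeftRight_apply, mul_assoc]
        exact Ideal.mul_mem_left _ _ (Ideal.mul_mem_mul hr ((hf0 _).mp hb))) ht
  have heK : e ∈ K := by
    intro r hr
    have hmem := mulLeftRight_mem_of_isTwoSided R e hr
    obtain ⟨z, hz⟩ := hcent (R * R) inferInstance (AlgHom.mulLeftRight Z B e r) fun c => by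
      have hk : (1 ⊗ₜ op c - c ⊗ₜ 1) * e ∈ K := by
        refine hker _ ?_
        rw [map_mul, map_sub, sub_mul, sub_eq_zero, he, he (envMap f (c ⊗ₜ 1))]
        simp
      simpa using hk r hr
    have hzR : algebraMap Z B z ∈ R := by
      have := R.sub_mem hmem (Ideal.mul_le_left hz)
      simpa using this
    rcases hunit z with h | h
    · simpa [h] using hz
    · exact absurd (Ideal.eq_top_of_isUnit_mem _ hzR h) hRtop
  have he0 : envMap f e ≠ 0 := by
    intro h
    rw [h] at he1
    simp at he1
  obtain ⟨t, htK, ht1⟩ := exists_mem_envMap_eq_one hf K heK he0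
  have h1K : (1 : B ⊗[Z] Bᵐᵒᵖ) ∈ K := by
    have := K.add_mem htK (hker (1 - t) (by rw [map_sub, ht1, map_one, sub_self]))
    simpa using this
  have hRR : R ≤ R * R := fun r hr => by simpa using h1K r hr
  have hRbot : R = ⊥ := by
    obtain ⟨n, hn⟩ := IsSemiprimaryRing.isNilpotent (R := B)
    have hpow : ∀ n : ℕ, R ≤ R ^ (n + 1) := by
      intro n
      induction n with
      | zero => rw [zero_add, Submodule.pow_one]
      | succ n ih =>
        rw [Submodule.pow_succ]
        exact hRR.trans (Ideal.mul_mono_left ih)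
    exact le_bot_iff.mp ((hpow n).trans ((Ideal.pow_le_pow_right n.le_succ).trans hn.le))
  exact IsSimpleRing.of_ringEquiv (RingEquiv.ofBijective (Ideal.Quotient.mk R)
    ((Ideal.Quotient.mk_bijective_iff_eq_bot R).mpr hRbot)).symm hS

end Simplicity

section LocalGeneration

open TensorProduct MulOpposite

theorem map_pow_le_pow_smul {Z M : Type*} [CommRing Z] [AddCommGroup M] [Module Z M] (m : Ideal Z)
    (N : Submodule Z M) (ρ : Module.End Z M) (h : N.map ρ ≤ m • N) (n : ℕ) :
    N.map (ρ ^ n) ≤ m ^ n • N := by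
  induction n with
  | zero => simp [Module.End.one_eq_id]
  | succ n ih =>
    rw [pow_succ' ρ, Module.End.mul_eq_comp, Submodule.map_comp]
    refine (Submodule.map_mono ih).trans ?_
    rw [Submodule.map_smul'', pow_succ, mul_smul]
    exact Submodule.smul_mono le_rfl h

theorem exists_of_mem_span_isCasimir {Z A : Type*} [CommRing Z] [Ring A] [Algebra Z A]
    (h : (1 : A ⊗[Z] Aᵐᵒᵖ) ∈ casimirIdeal Z A) :
    ∃ (n : ℕ) (a : Fin n → A) (e : Fin n → A ⊗[Z] Aᵐᵒᵖ), (∀ i, IsCasimir Z (e i)) ∧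
      ∑ i, (a i ⊗ₜ 1) * e i = 1 := by
  obtain ⟨n, t, e, h⟩ := Submodule.mem_span_set'.mp h
  refine ⟨n, fun i => AlgHom.mulLeftRight Z A (t i) 1, fun i => e i, fun i => (e i).2, ?_⟩
  rw [← h]
  exact Finset.sum_congr rfl fun i _ => ((e i).2 (t i)).symm

theorem smul_eq_zero_of_mem_smul {Z M : Type*} [CommRing Z] [AddCommGroup M] [Module Z M]
    {I : Ideal Z} {z : Z} (hz : ∀ r ∈ I, z * r = 0) (N : Submodule Z M) {x : M}
    (hx : x ∈ I • N) : z • x = 0 := by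
  induction hx using Submodule.smul_induction_on' with
  | smul r hr y hy => rw [← mul_smul, hz r hr, zero_smul]
  | add x hx y hy h1 h2 => rw [smul_add, h1, h2, add_zero]

/-- If `A` has a simple quotient `S` with kernel contained in `m A` whose enveloping algebra is simple
and has a normalized Casimir element, then Casimir elements of `A` generate the enveloping algebra
locally at `m`. -/
theorem smul_one_mem_casimirIdeal_of_surjective {Z A S : Type*} [CommRing Z] [Ring A]
    [Algebra Z A] [Ring S] [Algebra Z S] [IsSimpleRing (S ⊗[Z] Sᵐᵒᵖ)] {f : A →ₐ[Z] S}
    (hf : Function.Surjective f) {m : Ideal Z}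
    (hk : ∀ x, f x = 0 → x ∈ (m • ⊤ : Submodule Z A)) {e₀ : S ⊗[Z] Sᵐᵒᵖ}
    (hμe₀ : AlgHom.mulLeftRight Z S e₀ 1 = 1) (he₀ : IsCasimir Z e₀) (n : ℕ) {z : Z}
    (hz : ∀ r ∈ m ^ n, z * r = 0) (hz0 : algebraMap Z S z ≠ 0) :
    z • (1 : A ⊗[Z] Aᵐᵒᵖ) ∈ casimirIdeal Z A := by
  have hker : ∀ t : A ⊗[Z] Aᵐᵒᵖ, envMap f t = 0 → t ∈ (m • ⊤ : Submodule Z (A ⊗[Z] Aᵐᵒᵖ)) := by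
    intro t ht
    refine mem_of_envMap_eq_zero hf _ (fun a b ha => ?_) (fun a b hb => ?_) ht
    · exact Submodule.smul_top_le_comap_smul_top m ((TensorProduct.mk Z A Aᵐᵒᵖ).flip b) (hk a ha)
    · exact Submodule.smul_top_le_comap_smul_top m
        ((TensorProduct.mk Z A Aᵐᵒᵖ a) ∘ₗ (opLinearEquiv Z : A ≃ₗ[Z] Aᵐᵒᵖ).toLinearMap) (hk _ hb)
  obtain ⟨e₁, he₁, hμe₁⟩ : ∃ e₁, envMap f e₁ = e₀ ∧ AlgHom.mulLeftRight Z A e₁ 1 = 1 := by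
    obtain ⟨e, he⟩ := envMap_surjective hf e₀
    refine ⟨e + (1 - AlgHom.mulLeftRight Z A e 1) ⊗ₜ 1, ?_, by simp⟩
    have : f (AlgHom.mulLeftRight Z A e 1) = 1 := by
      rw [← mulLeftRight_envMap, he, map_one, hμe₀]
    rw [map_add, he, envMap_tmul, map_sub, this, map_one, sub_self, zero_tmul, add_zero]
  let μ : A ⊗[Z] Aᵐᵒᵖ →ₗ[Z] A :=
    (LinearMap.applyₗ (1 : A)) ∘ₗ (AlgHom.mulLeftRight Z A).toLinearMap
  have hμ : ∀ t, μ t = AlgHom.mulLeftRight Z A t 1 := fun _ => rfl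
  let Ψ : A ⊗[Z] Aᵐᵒᵖ →ₗ[Z] A ⊗[Z] Aᵐᵒᵖ :=
    LinearMap.id - (TensorProduct.mk Z A Aᵐᵒᵖ).flip 1 ∘ₗ μ
  have hΨ : ∀ t, Ψ t = t - μ t ⊗ₜ 1 := fun _ => rfl
  have hΨrange : (⊤ : Submodule Z _).map Ψ ≤ LinearMap.ker μ := by
    rintro _ ⟨t, -, rfl⟩
    rw [LinearMap.mem_ker, hΨ, map_sub, hμ (_ ⊗ₜ _)]
    simp
  have hΩ : ∀ t ∈ (m • ⊤ : Submodule Z (A ⊗[Z] Aᵐᵒᵖ)), μ t = 0 → t ∈ m • LinearMap.ker μ := by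
    intro t ht h0
    have h := Submodule.mem_map_of_mem (f := Ψ) ht
    rw [Submodule.map_smul'', hΨ, h0, zero_tmul, sub_zero] at h
    exact Submodule.smul_mono le_rfl hΨrange h
  have hμmul : ∀ s t, μ (s * t) = AlgHom.mulLeftRight Z A s (μ t) := fun s t => by
    rw [hμ, map_mul]
    rfl
  have hstep : (LinearMap.ker μ).map (LinearMap.mulRight Z e₁) ≤ m • LinearMap.ker μ := by
    rintro _ ⟨t, ht, rfl⟩
    have ht' : μ t = 0 := ht
    refine hΩ _ (hker _ ?_) ?_
    · rw [LinearMap.mulRight_apply, map_mul, he₁, he₀, ← map_one f, mulLeftRight_envMap, ← hμ, ht']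
      simp
    · rw [LinearMap.mulRight_apply, hμmul, hμ e₁, hμe₁, ← hμ, ht']
  have hpow := map_pow_le_pow_smul m _ _ hstep n
  have hΩe : ∀ t, μ t = 0 → z • (t * e₁ ^ n) = 0 := fun t ht => by
    have h := hpow (Submodule.mem_map_of_mem (LinearMap.mem_ker.mpr ht))
    rw [LinearMap.pow_mulRight] at h
    exact smul_eq_zero_of_mem_smul hz _ h
  have hμe : ∀ i : ℕ, μ (e₁ ^ i) = 1 := by
    intro i
    induction i with
    | zero => simp [hμ]
    | succ i ih => rw [pow_succ', hμmul, ih, hμe₁]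
  have hcas : IsCasimir Z (z • e₁ ^ n) := fun t => by
    have h := hΩe (t - μ t ⊗ₜ 1) 
      (hΨrange (Submodule.mem_map_of_mem (Submodule.mem_top (x := t))))
    rw [sub_mul, smul_sub, sub_eq_zero] at h
    rw [mul_smul_comm, mul_smul_comm, h, hμ]
  have hne : envMap f (z • e₁ ^ n) ≠ 0 := by
    intro h
    have h1 := mulLeftRight_envMap f (z • e₁ ^ n) 1
    rw [h, map_zero, LinearMap.zero_apply, map_smul, LinearMap.smul_apply, ← hμ, hμe, map_smul,
      map_one, ← Algebra.algebraMap_eq_smul_one] at h1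
    exact hz0 h1.symm
  obtain ⟨c, hc, hc1⟩ := exists_mem_envMap_eq_one hf (casimirIdeal Z A)
    (Ideal.subset_span hcas) hne
  have hu : (⊤ : Submodule Z _).map (LinearMap.mulRight Z (1 - c)) ≤ m • ⊤ := by
    rintro _ ⟨t, -, rfl⟩
    refine hker _ ?_
    rw [LinearMap.mulRight_apply, map_mul, map_sub, hc1, map_one, sub_self, mul_zero]
  have hun := map_pow_le_pow_smul m _ _ hu n (Submodule.mem_map_of_mem (Submodule.mem_top (x := 1)))
  rw [LinearMap.pow_mulRight, LinearMap.mulRight_apply, one_mul] at hun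
  have hzu := smul_eq_zero_of_mem_smul hz _ hun
  have hmod : ∀ i : ℕ, 1 - (1 - c) ^ i ∈ casimirIdeal Z A := by
    intro i
    induction i with
    | zero => simp
    | succ i ih =>
      have : 1 - (1 - c) ^ (i + 1) = (1 - (1 - c) ^ i) + (1 - c) ^ i * c := by
        rw [pow_succ, mul_sub, mul_one]
        abel
      rw [this]
      exact Ideal.add_mem _ ih (Ideal.mul_mem_left _ _ hc)
  have h := Ideal.mul_mem_left _ (algebraMap Z _ z) (hmod n)
  rwa [← Algebra.smul_def, smul_sub, hzu, sub_zero] at h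

theorem smul_one_mem_casimirIdeal {Z A : Type*} [CommRing Z] [Ring A] [Algebra Z A]
    [Module.Finite Z A] [IsArtinianRing Z] (hinj : Function.Injective (algebraMap Z A))
    (hcent : ∀ I : Ideal A, I.IsTwoSided → ∀ b, (∀ c, b * c - c * b ∈ I) →
      ∃ z : Z, b - algebraMap Z A z ∈ I)
    (m : Ideal Z) [m.IsMaximal] (n : ℕ) {z : Z} (hzm : z ∉ m) (hz : ∀ r ∈ m ^ n, z * r = 0) :
    z • (1 : A ⊗[Z] Aᵐᵒᵖ) ∈ casimirIdeal Z A := by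
  let 𝔞 : Ideal A :=
    { carrier := (m • ⊤ : Submodule Z A)
      add_mem' := Submodule.add_mem _
      zero_mem' := Submodule.zero_mem _
      smul_mem' := fun c _ hx =>
        Submodule.smul_top_le_comap_smul_top m (LinearMap.mulLeft Z c) hx }
  have h𝔞 : 𝔞.IsTwoSided := ⟨fun {_} b ha =>
    Submodule.smul_top_le_comap_smul_top m (LinearMap.mulRight Z b) ha⟩
  have hmem𝔞 : ∀ x, x ∈ 𝔞 ↔ x ∈ (m • ⊤ : Submodule Z A) := fun _ => Iff.rfl
  have hm𝔞 : ∀ r ∈ m, algebraMap Z A r ∈ 𝔞 := fun r hr => by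
    rw [hmem𝔞, Algebra.algebraMap_eq_smul_one]
    exact Submodule.smul_mem_smul hr trivial
  have htop : 𝔞 ≠ ⊤ := by
    intro h
    have h1 : (m • ⊤ : Submodule Z A) = ⊤ := by
      refine eq_top_iff.mpr fun x _ => ?_
      rw [← hmem𝔞, h]
      trivial
    have h2 : ∀ i : ℕ, (m ^ i • ⊤ : Submodule Z A) = ⊤ := by
      intro i
      induction i with
      | zero => simp
      | succ i ih => rw [pow_succ, mul_smul, h1, ih]
    have h3 := smul_eq_zero_of_mem_smul hz (⊤ : Submodule Z A) (x := 1)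
      (by rw [h2]; trivial)
    rw [← Algebra.algebraMap_eq_smul_one] at h3
    exact hzm ((hinj (h3.trans (map_zero _).symm)) ▸ m.zero_mem)
  have hnt : Nontrivial (A ⧸ 𝔞) := Ideal.Quotient.nontrivial_iff.mpr htop
  let f : A →ₐ[Z] A ⧸ 𝔞 := Ideal.Quotient.mkₐ Z 𝔞
  have hf : Function.Surjective f := Ideal.Quotient.mkₐ_surjective Z 𝔞
  have hf0 : ∀ x, f x = 0 ↔ x ∈ 𝔞 := fun x => Ideal.Quotient.eq_zero_iff_mem
  have hfin : Module.Finite Z (A ⧸ 𝔞) := Module.Finite.of_surjective f.toLinearMap hf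
  have hart : IsArtinianRing (A ⧸ 𝔞) := IsArtinianRing.of_finite Z _
  have hcentS : ∀ I : Ideal (A ⧸ 𝔞), I.IsTwoSided → ∀ b, (∀ c, b * c - c * b ∈ I) →
      ∃ z : Z, b - algebraMap Z (A ⧸ 𝔞) z ∈ I := by
    intro I hI b hb
    obtain ⟨b, rfl⟩ := hf b
    obtain ⟨y, hy⟩ := hcent (I.comap f.toRingHom) inferInstance b fun c => by
      have := hb (f c)
      rw [← map_mul, ← map_mul, ← map_sub] at this
      exact this
    refine ⟨y, ?_⟩
    have hy' : f (b - algebraMap Z A y) ∈ I := hy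
    rwa [map_sub, f.commutes] at hy'
  have hunit : ∀ y : Z, y ∉ m → IsUnit (algebraMap Z (A ⧸ 𝔞) y) := by
    intro y hy
    obtain ⟨x, hx⟩ := Ideal.Quotient.exists_inv (I := m)
      (a := Ideal.Quotient.mk m y) (by rwa [Ne, Ideal.Quotient.eq_zero_iff_mem])
    obtain ⟨x, rfl⟩ := Ideal.Quotient.mk_surjective x
    rw [← map_mul, ← map_one (Ideal.Quotient.mk m), Ideal.Quotient.eq] at hx
    have h1 := (hf0 _).mpr (hm𝔞 _ hx)
    rw [f.commutes, map_sub, map_one, sub_eq_zero] at h1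
    refine ⟨⟨algebraMap Z _ y, algebraMap Z _ x, ?_, ?_⟩, rfl⟩
    · rw [← map_mul, h1]
    · rw [← map_mul, mul_comm, h1]
  have hS : IsSimpleRing (A ⧸ 𝔞) := isSimpleRing_of_center Z _ (fun y => by
    by_cases hy : y ∈ m
    · left
      rw [← f.commutes, hf0]
      exact hm𝔞 y hy
    · exact Or.inr (hunit y hy)) hcentS
  obtain ⟨hSe, e₀, hμe₀, he₀⟩ := exists_isCasimir_of_simple Z (A ⧸ 𝔞) fun c hc => by
    obtain ⟨y, hy⟩ := hcentS ⊥ inferInstance c fun b => by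
      rw [Subring.mem_center_iff.mp hc b, sub_self]
      exact Ideal.zero_mem _
    exact ⟨y, (sub_eq_zero.mp hy).symm⟩
  exact smul_one_mem_casimirIdeal_of_surjective hf (fun x hx => (hf0 x).mp hx) hμe₀ he₀ n hz
    (hunit z hzm).ne_zero

end LocalGeneration

section CasimirGeneration

open TensorProduct MulOpposite

theorem one_mem_casimirIdeal {Z A : Type*} [CommRing Z] [Ring A] [Algebra Z A]
    [Module.Finite Z A] [IsArtinianRing Z] (hinj : Function.Injective (algebraMap Z A))
    (hcent : ∀ I : Ideal A, I.IsTwoSided → ∀ b, (∀ c, b * c - c * b ∈ I) →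
      ∃ z : Z, b - algebraMap Z A z ∈ I) :
    (1 : A ⊗[Z] Aᵐᵒᵖ) ∈ casimirIdeal Z A := by
  set T : Ideal Z := (casimirIdeal Z A).comap (algebraMap Z (A ⊗[Z] Aᵐᵒᵖ)) with hTdef
  suffices h : T = ⊤ by
    have h1 : (1 : Z) ∈ T := h ▸ Submodule.mem_top
    rw [hTdef, Ideal.mem_comap, map_one] at h1
    exact h1
  by_contra hT
  obtain ⟨m, hm, hTm⟩ := Ideal.exists_le_maximal T hT
  obtain ⟨n, hn⟩ := IsArtinian.monotone_stabilizes
    (⟨fun i => OrderDual.toDual (m ^ i), fun _ _ h => Ideal.pow_le_pow_right h⟩ :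
      ℕ →o (Ideal Z)ᵒᵈ)
  have hstab : ∀ i, n ≤ i → m ^ n = m ^ i := hn
  have hidem : IsIdempotentElem (m ^ (n + 1)) := by
    rw [IsIdempotentElem, ← pow_add, ← hstab (n + 1) (by omega), ← hstab _ (by omega)]
  obtain ⟨f, hf, hI⟩ := (Ideal.isIdempotentElem_iff_of_fg _ (IsNoetherian.noetherian _)).mp hidem
  have hfm : f ∈ m := Ideal.pow_le_self n.succ_ne_zero
    (hI ▸ Ideal.mem_span_singleton_self f)
  have hzm : 1 - f ∉ m := fun h =>
    hm.ne_top (m.eq_top_iff_one.mpr (by simpa using m.add_mem h hfm))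
  refine hzm (hTm ?_)
  have h := smul_one_mem_casimirIdeal hinj hcent m (n + 1) hzm fun r hr => by
    rw [hI] at hr
    obtain ⟨a, rfl⟩ := Ideal.mem_span_singleton'.mp hr
    rw [mul_left_comm, sub_mul, one_mul, hf.eq, sub_self, mul_zero]
  rwa [← Algebra.algebraMap_eq_smul_one] at h

theorem IsCasimir.mul_mulLeftRight {Z A : Type*} [CommRing Z] [Ring A] [Algebra Z A]
    {e : A ⊗[Z] Aᵐᵒᵖ} (he : IsCasimir Z e) (x b : A) :
    AlgHom.mulLeftRight Z A e x * b = b * AlgHom.mulLeftRight Z A e x := by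
  have h := DFunLike.congr_fun (congrArg (AlgHom.mulLeftRight Z A) (he (1 ⊗ₜ op b))) x
  simpa using h

theorem projective_and_bijective_of_casimir {Z A : Type*} [CommRing Z] [Ring A] [Algebra Z A]
    (hinj : Function.Injective (algebraMap Z A))
    (hcenter : ∀ c : A, (∀ b, c * b = b * c) → ∃ z, algebraMap Z A z = c)
    (h : (1 : A ⊗[Z] Aᵐᵒᵖ) ∈ casimirIdeal Z A) :
    Module.Projective Z A ∧ Function.Bijective (AlgHom.mulLeftRight Z A) := by
  obtain ⟨n, a, e, he, hae⟩ := exists_of_mem_span_isCasimir h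
  have hφ : ∀ i, ∃ φ : A →ₗ[Z] Z, ∀ x, algebraMap Z A (φ x) = AlgHom.mulLeftRight Z A (e i) x := by
    intro i
    choose φ hφ using fun x => hcenter _ ((he i).mul_mulLeftRight x)
    refine ⟨⟨⟨φ, fun x y => hinj ?_⟩, fun c x => hinj ?_⟩, hφ⟩
    · simp [hφ]
    · rw [hφ, map_smul, RingHom.id_apply, smul_eq_mul, map_mul, hφ, Algebra.smul_def]
  choose φ hφ using hφ
  have hsum : ∀ x, ∑ i, φ i x • a i = x := by
    intro x
    have h := DFunLike.congr_fun (congrArg (AlgHom.mulLeftRight Z A) hae) x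
    simp only [map_sum, map_mul, map_one, LinearMap.sum_apply, Module.End.mul_apply,
      Module.End.one_apply, AlgHom.mulLeftRight_apply, unop_one, mul_one] at h
    refine Eq.trans (Finset.sum_congr rfl fun i _ => ?_) h
    rw [Algebra.smul_def, Algebra.commutes, hφ]
  refine ⟨Module.Projective.of_split (LinearMap.pi φ) (Fintype.linearCombination Z a)
    (LinearMap.ext fun x => ?_), ?_, ?_⟩
  · simp [Fintype.linearCombination_apply, hsum]
  · refine (injective_iff_map_eq_zero _).mpr fun t ht => ?_
    rw [← mul_one t, ← hae, Finset.mul_sum]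
    refine Finset.sum_eq_zero fun i _ => ?_
    rw [← mul_assoc, he i, map_mul, ht, zero_mul, LinearMap.zero_apply, zero_tmul, zero_mul]
  · intro g
    refine ⟨∑ i, (g (a i) ⊗ₜ 1) * e i, LinearMap.ext fun x => ?_⟩
    conv_rhs => rw [← hsum x]
    simp only [map_sum, map_mul, LinearMap.sum_apply, Module.End.mul_apply,
      AlgHom.mulLeftRight_apply, unop_one, mul_one, map_smul]
    refine Finset.sum_congr rfl fun i _ => ?_
    rw [Algebra.smul_def, Algebra.commutes, hφ]

end CasimirGeneration

section Trace

open TensorProduct MulOpposite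

theorem exists_linearMap_apply_one_eq_one (Z A : Type*) [CommRing Z] [Ring A] [Algebra Z A]
    [Module.Finite Z A] [Module.Projective Z A] (hinj : Function.Injective (algebraMap Z A)) :
    ∃ φ : A →ₗ[Z] Z, φ 1 = 1 := by
  let T : Ideal Z := LinearMap.range (LinearMap.applyₗ (R := Z) (M₂ := Z) (1 : A))
  have hmem : ∀ (f : A →ₗ[Z] Z) (x : A), f x ∈ T := fun f x =>
    ⟨f ∘ₗ LinearMap.mulRight Z x, by simp⟩
  obtain ⟨n, f, g, -, -, hfg⟩ := Module.Finite.exists_comp_eq_id_of_projective Z A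
  have hT : (⊤ : Submodule Z A) ≤ T • ⊤ := by
    intro x _
    have hx : f (g x) = x := LinearMap.congr_fun hfg x
    rw [← hx, pi_eq_sum_univ (g x), map_sum]
    refine Submodule.sum_mem _ fun i _ => ?_
    rw [map_smul]
    exact Submodule.smul_mem_smul (hmem (LinearMap.proj i ∘ₗ g) x) Submodule.mem_top
  obtain ⟨r, hr, hr0⟩ := Submodule.exists_sub_one_mem_and_smul_eq_zero_of_fg_of_le_smul T ⊤
    Module.Finite.fg_top hT
  have hr1 : r = 0 := hinj (by
    rw [map_zero, Algebra.algebraMap_eq_smul_one]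
    exact hr0 1 Submodule.mem_top)
  rw [hr1, zero_sub, neg_mem_iff] at hr
  exact hr

theorem map_mulLeftRight_of_central {Z A B : Type*} [CommRing Z] [Ring A] [Algebra Z A] [Ring B]
    (π : A →+* B) {x : A} (hx : ∀ b, b * π x = π x * b) (t : A ⊗[Z] Aᵐᵒᵖ) :
    π (AlgHom.mulLeftRight Z A t x) = π x * π (AlgHom.mulLeftRight Z A t 1) := by
  induction t with
  | zero => simp
  | add a b ha hb => simp [ha, hb, mul_add]
  | tmul a b =>
    rw [AlgHom.mulLeftRight_apply, AlgHom.mulLeftRight_apply, map_mul, map_mul, hx, mul_one,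
      map_mul, mul_assoc]

end Trace

theorem azumayaMap_apply (k A : Type) [Field k] [Ring A] [Algebra k A]
    (t : TensorProduct (Subalgebra.center k A) A Aᵐᵒᵖ) :
    azumayaMap k A t = AlgHom.mulLeftRight (Subalgebra.center k A) A t := by
  induction t with
  | zero => simp
  | add a b ha hb => rw [map_add, map_add, ha, hb]
  | tmul a b =>
    ext x
    simp [azumayaMap]

/-- A finite-dimensional associative unital algebra `A` over a field `k` is
an Azumaya algebra over its center if and only if every surjective homomorphism of unital
`k`-algebras `π : A → B` maps the center of `A` onto the center of `B`. -/
theorem statement13 (k A : Type) [Field k] [Ring A] [Algebra k A] [FiniteDimensional k A] :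
    IsAzumayaOverCenter k A ↔
      ∀ (B : Type) [Ring B] [Algebra k B] (π : A →ₐ[k] B), Function.Surjective π →
        Subalgebra.map π (Subalgebra.center k A) = Subalgebra.center k B := by
  have hinj : Function.Injective (algebraMap (Subalgebra.center k A) A) := Subtype.val_injective
  have hbij : Function.Bijective (azumayaMap k A) ↔
      Function.Bijective (AlgHom.mulLeftRight (Subalgebra.center k A) A) :=
    iff_of_eq (congrArg _ (funext (azumayaMap_apply k A)))
  constructor
  · rintro ⟨-, _, _, hb⟩ B _ _ π hπ
    refine le_antisymm ?_ fun w hw => ?_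
    · rintro _ ⟨c, hc, rfl⟩
      rw [Subalgebra.mem_center_iff]
      intro b
      obtain ⟨b, rfl⟩ := hπ b
      have h := Subalgebra.mem_center_iff.mp hc b
      rw [AlgHom.coe_toRingHom, ← map_mul, h, map_mul]
    · obtain ⟨x, rfl⟩ := hπ w
      obtain ⟨φ, hφ⟩ := exists_linearMap_apply_one_eq_one (Subalgebra.center k A) A hinj
      obtain ⟨t, ht⟩ := (hbij.mp hb).2 ((Algebra.linearMap (Subalgebra.center k A) A) ∘ₗ φ)
      have h := map_mulLeftRight_of_central (π : A →+* B) (Subalgebra.mem_center_iff.mp hw) t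
      refine ⟨φ x, (φ x).2, ?_⟩
      simpa [ht, hφ, algebraMap_center_apply] using h
  · intro H
    have : Module.Finite (Subalgebra.center k A) A :=
      Module.Finite.of_restrictScalars_finite k _ _
    have : IsArtinianRing (Subalgebra.center k A) := IsArtinianRing.of_finite k _
    have hcent : ∀ I : Ideal A, I.IsTwoSided → ∀ b, (∀ c, b * c - c * b ∈ I) →
        ∃ z : Subalgebra.center k A, b - algebraMap (Subalgebra.center k A) A z ∈ I := by
      intro I _ b hb
      have hmem : Ideal.Quotient.mkₐ k I b ∈ Subalgebra.center k (A ⧸ I) := by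
        rw [Subalgebra.mem_center_iff]
        intro c
        obtain ⟨c, rfl⟩ := Ideal.Quotient.mkₐ_surjective k I c
        rw [← map_mul, ← map_mul, eq_comm]
        exact Ideal.Quotient.eq.mpr (hb c)
      rw [← H (A ⧸ I) (Ideal.Quotient.mkₐ k I) (Ideal.Quotient.mkₐ_surjective k I)] at hmem
      obtain ⟨c, hc, hcb⟩ := hmem
      exact ⟨⟨c, hc⟩, Ideal.Quotient.eq.mp hcb.symm⟩
    obtain ⟨hp, hb⟩ := projective_and_bijective_of_casimir hinj
      (fun c hc => ⟨⟨c, Subalgebra.mem_center_iff.mpr fun b => (hc b).symm⟩, rfl⟩)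
      (one_mem_casimirIdeal hinj hcent)
    refine ⟨⟨fun h => ?_⟩, inferInstance, hp, hbij.mpr hb⟩
    have h1 := h (1 : A)
    exact Subtype.ext (by simpa [Subalgebra.smul_def] using h1)
end

section
/- Let A be a finite-dimensional associative unital algebra over a field k with algebraic closure k̄. Then A is an Azumaya algebra over its center Z(A) if and only if A ⊗_k k̄ is isomorphic as a k̄-algebra to a finite direct product of matrix algebras M_{n_i}(K_i) over finite-dimensional commutative unital k̄-algebras K_i. -/
open TensorProduct
set_option synthInstance.maxHeartbeats 1000000
set_option maxHeartbeats 1000000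

open TensorProduct in
/-- A decomposition of an algebra `B` over a field `kb` as a finite direct product of matrix
algebras `M_{n i}(K i)` over finite-dimensional commutative unital `kb`-algebras `K i`. -/
structure MatrixDecomp (kb : Type) [Field kb] (B : Type) [Ring B] [Algebra kb B] : Type 1 where
  s : ℕ
  n : Fin s → ℕ
  npos : ∀ i, 0 < n i
  K : Fin s → Type
  [commRing : ∀ i, CommRing (K i)]
  [alg : ∀ i, Algebra kb (K i)]
  findim : ∀ i, FiniteDimensional kb (K i)
  iso : Nonempty (B ≃ₐ[kb] ((i : Fin s) → Matrix (Fin (n i)) (Fin (n i)) (K i)))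

open TensorProduct in
/-- A presentation of an algebra `B` over a field `kb` as a matrix algebra `M_n(K)` over a
finite-dimensional commutative unital `kb`-algebra `K`. -/
structure MatrixAlgDecomp (kb : Type) [Field kb] (B : Type) [Ring B] [Algebra kb B]
    (n : ℕ) : Type 1 where
  K : Type
  [commRing : CommRing K]
  [alg : Algebra kb K]
  findim : FiniteDimensional kb K
  iso : Nonempty (B ≃ₐ[kb] Matrix (Fin n) (Fin n) K)

open TensorProduct in
/-- `A` is a maximally central algebra over `k`: after extension of scalars to the algebraic
closure `k̄` it becomes a finite direct product of matrix algebras over finite-dimensional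
commutative `k̄`-algebras. -/
def IsMaximallyCentral (k : Type) [Field k] (A : Type) [Ring A] [Algebra k A] : Prop :=
  Nonempty (MatrixDecomp (AlgebraicClosure k) (AlgebraicClosure k ⊗[k] A))

open TensorProduct in
/-- `A` is an equidimensional maximally central algebra over `k` with parameter `n`:
`A ⊗[k] k̄ ≅ M_n(K)` for some finite-dimensional commutative `k̄`-algebra `K`. -/
def IsEquidimMaximallyCentral (k : Type) [Field k] (A : Type) [Ring A] [Algebra k A]
    (n : ℕ) : Prop :=
  Nonempty (MatrixAlgDecomp (AlgebraicClosure k) (AlgebraicClosure k ⊗[k] A) n)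

section BimoduleEndomorphisms

variable (R A : Type) [CommRing R] [Ring A] [Algebra R A]

/-- The `R`-linear span of the two-sided multiplications `x ↦ a * x * b` on an algebra `A`. -/
def mulLeftRightSpan : Submodule R (Module.End R A) :=
  Submodule.span R (Set.range (LinearMap.mulLeftRight R (A := A)))

/-- `A` has a finite dual basis over `R` whose coordinate functions, viewed as endomorphisms
of `A`, are sums of two-sided multiplications. -/
def HasBimoduleDualBasis : Prop :=
  ∃ (n : ℕ) (x : Fin n → A) (f : Fin n → A →ₗ[R] R),
    (∀ y, ∑ i, f i y • x i = y) ∧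
      ∀ i, (Algebra.linearMap R A).comp (f i) ∈ mulLeftRightSpan R A

variable {R A}

theorem mulLeftRight_mem_mulLeftRightSpan (a b : A) :
    LinearMap.mulLeftRight R (a, b) ∈ mulLeftRightSpan R A :=
  Submodule.subset_span ⟨_, rfl⟩

@[elab_as_elim]
theorem mulLeftRightSpan_induction {p : ∀ F : Module.End R A, F ∈ mulLeftRightSpan R A → Prop}
    (mul : ∀ a b, p (LinearMap.mulLeftRight R (a, b)) (mulLeftRight_mem_mulLeftRightSpan a b))
    (zero : p 0 (zero_mem _))
    (add : ∀ F G hF hG, p F hF → p G hG → p (F + G) (add_mem hF hG)) {F : Module.End R A}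
    (hF : F ∈ mulLeftRightSpan R A) : p F hF := by
  refine Submodule.closure_induction zero (fun F G hF hG => add F G hF hG) ?_ hF
  rintro r _ ⟨⟨a, b⟩, rfl⟩
  have h : r • LinearMap.mulLeftRight R (a, b) = LinearMap.mulLeftRight R (r • a, b) := by
    ext x
    simp
  simpa only [h] using mul (r • a) b

theorem mulLeft_comp_mem_mulLeftRightSpan (c : A) {F : Module.End R A}
    (hF : F ∈ mulLeftRightSpan R A) : LinearMap.mulLeft R c ∘ₗ F ∈ mulLeftRightSpan R A := by
  induction hF using mulLeftRightSpan_induction with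
  | mul a b =>
    convert mulLeftRight_mem_mulLeftRightSpan (R := R) (c * a) b using 1
    ext x
    simp [mul_assoc]
  | zero => simp
  | add F G _ _ hF hG => rw [LinearMap.comp_add]; exact add_mem hF hG

theorem baseChange_mem_mulLeftRightSpan (S : Type) [CommRing S] [Algebra R S]
    {F : Module.End R A} (hF : F ∈ mulLeftRightSpan R A) :
    F.baseChange S ∈ mulLeftRightSpan S (S ⊗[R] A) := by
  induction hF using mulLeftRightSpan_induction with
  | mul a b =>
    convert mulLeftRight_mem_mulLeftRightSpan (R := S) ((1 : S) ⊗ₜ[R] a) ((1 : S) ⊗ₜ[R] b) using 1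
    ext x
    simp
  | zero => simp
  | add F G _ _ hF hG => rw [LinearMap.baseChange_add]; exact add_mem hF hG

namespace HasBimoduleDualBasis

theorem finite (h : HasBimoduleDualBasis R A) : Module.Finite R A := by
  obtain ⟨n, x, f, hx, -⟩ := h
  refine Module.Finite.of_surjective (Fintype.linearCombination R x) fun y => ⟨fun i => f i y, ?_⟩
  simpa [Fintype.linearCombination_apply] using hx y

theorem projective (h : HasBimoduleDualBasis R A) : Module.Projective R A := by
  obtain ⟨n, x, f, hx, -⟩ := h
  refine Module.Projective.of_split (LinearMap.pi f) (Fintype.linearCombination R x) ?_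
  ext y
  simpa [Fintype.linearCombination_apply] using hx y

theorem mulLeftRightSpan_eq_top (h : HasBimoduleDualBasis R A) : mulLeftRightSpan R A = ⊤ := by
  obtain ⟨n, x, f, hx, hf⟩ := h
  refine eq_top_iff.mpr fun F _ => ?_
  have hF : F = ∑ i, LinearMap.mulLeft R (F (x i)) ∘ₗ (Algebra.linearMap R A).comp (f i) := by
    ext y
    conv_lhs => rw [← hx y]
    simp [← Algebra.commutes, ← Algebra.smul_def]
  rw [hF]
  exact sum_mem fun i _ => mulLeft_comp_mem_mulLeftRightSpan _ (hf i)

theorem baseChange (h : HasBimoduleDualBasis R A) (S : Type) [CommRing S] [Algebra R S] :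
    HasBimoduleDualBasis S (S ⊗[R] A) := by
  obtain ⟨n, x, f, hx, hf⟩ := h
  refine ⟨n, fun i => 1 ⊗ₜ x i,
    fun i => (AlgebraTensorModule.rid R S S).toLinearMap ∘ₗ (f i).baseChange S, ?_, ?_⟩
  · intro y
    induction y with
    | zero => simp
    | add y z hy hz =>
      simp only [map_add, add_smul, Finset.sum_add_distrib]
      rw [hy, hz]
    | tmul s y =>
      conv_rhs => rw [← hx y]
      simp only [LinearMap.comp_apply, LinearMap.baseChange_tmul, LinearEquiv.coe_coe,
        AlgebraTensorModule.rid_tmul, TensorProduct.smul_tmul', TensorProduct.tmul_sum,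
        TensorProduct.tmul_smul, smul_eq_mul, mul_one, smul_assoc]
  · intro i
    convert baseChange_mem_mulLeftRightSpan S (hf i) using 1
    ext y
    simp [Algebra.algebraMap_eq_smul_one]
    rw [Algebra.TensorProduct.one_def]

end HasBimoduleDualBasis

end BimoduleEndomorphisms

section Center

variable (k A : Type) [Field k] [Ring A] [Algebra k A]

/-- The algebra structure of `A` over its center. -/
abbrev centerAlgebra_s14 : Algebra (Subalgebra.center k A) A :=
  Algebra.ofModule (fun c x y => mul_assoc (c : A) x y) fun c x y => by
    show x * ((c : A) * y) = (c : A) * (x * y)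
    rw [← mul_assoc, Subalgebra.mem_center_iff.mp c.2 x, mul_assoc]

attribute [local instance] centerAlgebra_s14

theorem center_smul_def (c : Subalgebra.center k A) (x : A) : c • x = (c : A) * x := rfl

theorem azumayaMap_tmul (a b x : A) :
    azumayaMap k A (a ⊗ₜ MulOpposite.op b) x = a * x * b := rfl

theorem algebraMap_center_apply_s14 (c : Subalgebra.center k A) :
    algebraMap (Subalgebra.center k A) A c = c := mul_one (c : A)

theorem azumayaMap_tmul_eq_mulLeftRight (a b : A) :
    azumayaMap k A (a ⊗ₜ MulOpposite.op b) =
      LinearMap.mulLeftRight (Subalgebra.center k A) (a, b) := by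
  ext x
  simp [azumayaMap_tmul]

theorem range_azumayaMap :
    LinearMap.range (azumayaMap k A) = mulLeftRightSpan (Subalgebra.center k A) A := by
  apply le_antisymm
  · rintro _ ⟨u, rfl⟩
    induction u with
    | zero => simp
    | add u v hu hv => rw [map_add]; exact add_mem hu hv
    | tmul a b =>
      obtain ⟨b, rfl⟩ := MulOpposite.op_surjective b
      rw [azumayaMap_tmul_eq_mulLeftRight]
      exact mulLeftRight_mem_mulLeftRightSpan a b
  · refine Submodule.span_le.mpr ?_
    rintro _ ⟨⟨a, b⟩, rfl⟩
    exact ⟨a ⊗ₜ MulOpposite.op b, azumayaMap_tmul_eq_mulLeftRight k A a b⟩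

variable {k A} in
theorem exists_linearMap_mul_apply {F : Module.End (Subalgebra.center k A) A}
    (hF : F ∈ mulLeftRightSpan (Subalgebra.center k A) A) :
    ∃ Ψ : Module.End (Subalgebra.center k A) A →ₗ[Subalgebra.center k A] A,
      ∀ a b, Ψ (LinearMap.mulLeftRight _ (a, b)) = a * F b := by
  induction hF using mulLeftRightSpan_induction with
  | mul c d =>
    refine ⟨LinearMap.mulRight _ d ∘ₗ LinearMap.applyₗ c, fun a b => ?_⟩
    simp [mul_assoc]
  | zero => exact ⟨0, by simp⟩
  | add F G _ _ hF hG =>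
    obtain ⟨Φ, hΦ⟩ := hF
    obtain ⟨Ψ, hΨ⟩ := hG
    exact ⟨Φ + Ψ, by simp [hΦ, hΨ, mul_add]⟩

theorem azumayaMap_injective (h : HasBimoduleDualBasis (Subalgebra.center k A) A) :
    Function.Injective (azumayaMap k A) := by
  obtain ⟨n, x, f, hx, hf⟩ := h
  choose Ψ hΨ using fun i => exists_linearMap_mul_apply (hf i)
  have key : ∀ u, u = ∑ i, Ψ i (azumayaMap k A u) ⊗ₜ[Subalgebra.center k A]
      MulOpposite.op (x i) := by
    intro u
    induction u with
    | zero => simp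
    | add u v hu hv =>
      simp only [map_add, TensorProduct.add_tmul, Finset.sum_add_distrib]
      rw [← hu, ← hv]
    | tmul a b =>
      obtain ⟨b, rfl⟩ := MulOpposite.op_surjective b
      conv_lhs => rw [← hx b]
      rw [Finset.op_sum, TensorProduct.tmul_sum]
      refine Finset.sum_congr rfl fun i _ => ?_
      rw [azumayaMap_tmul_eq_mulLeftRight, hΨ, LinearMap.comp_apply, Algebra.linearMap_apply,
        ← Algebra.commutes, ← Algebra.smul_def, TensorProduct.smul_tmul]
      rfl
  refine (injective_iff_map_eq_zero _).mpr fun u hu => ?_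
  rw [key u]
  simp [hu]

theorem isAzumayaOverCenter_iff_hasBimoduleDualBasis :
    IsAzumayaOverCenter k A ↔ HasBimoduleDualBasis (Subalgebra.center k A) A := by
  constructor
  · rintro ⟨-, hfin, hproj, -, hsurj⟩
    obtain ⟨n, p, hp⟩ := Module.Finite.exists_fin' (Subalgebra.center k A) A
    obtain ⟨s, hs⟩ := Module.projective_lifting_property p LinearMap.id hp
    refine ⟨n, fun i => p (Pi.single i 1), fun i => LinearMap.proj i ∘ₗ s, fun y => ?_, ?_⟩
    · conv_rhs => rw [← LinearMap.id_apply (R := Subalgebra.center k A) y, ← hs,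
        LinearMap.comp_apply, pi_eq_sum_univ' (s y), map_sum]
      simp
    · intro i
      rw [← range_azumayaMap, LinearMap.range_eq_top.mpr hsurj]
      trivial
  · intro h
    refine ⟨⟨fun {c d} hcd => ?_⟩, h.finite, h.projective, azumayaMap_injective k A h,
      LinearMap.range_eq_top.mp ((range_azumayaMap k A).trans h.mulLeftRightSpan_eq_top)⟩
    simpa [center_smul_def] using hcd 1

/-- The span of the endomorphisms `y ↦ x * t y` where `t` is a sum of two-sided multiplications
with values in the center. -/
def centralValuedSpan : Submodule k (Module.End k A) :=
  Submodule.span k {F | ∃ (x : A) (t : Module.End k A), t ∈ mulLeftRightSpan k A ∧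
    (∀ y, t y ∈ Subalgebra.center k A) ∧ F = LinearMap.mulLeft k x ∘ₗ t}

variable {k A}

theorem restrictScalars_mem_mulLeftRightSpan {F : Module.End (Subalgebra.center k A) A}
    (hF : F ∈ mulLeftRightSpan (Subalgebra.center k A) A) :
    F.restrictScalars k ∈ mulLeftRightSpan k A := by
  induction hF using mulLeftRightSpan_induction with
  | mul a b => exact mulLeftRight_mem_mulLeftRightSpan a b
  | zero => exact zero_mem _
  | add F G _ _ hF hG => exact add_mem hF hG

theorem exists_restrictScalars_eq {t : Module.End k A} (ht : t ∈ mulLeftRightSpan k A) :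
    ∃ F ∈ mulLeftRightSpan (Subalgebra.center k A) A, F.restrictScalars k = t := by
  induction ht using mulLeftRightSpan_induction with
  | mul a b => exact ⟨_, mulLeftRight_mem_mulLeftRightSpan a b, rfl⟩
  | zero => exact ⟨0, zero_mem _, rfl⟩
  | add F G _ _ hF hG =>
    obtain ⟨F, hF, rfl⟩ := hF
    obtain ⟨G, hG, rfl⟩ := hG
    exact ⟨F + G, add_mem hF hG, rfl⟩

theorem hasBimoduleDualBasis_center_iff :
    HasBimoduleDualBasis (Subalgebra.center k A) A ↔
      LinearMap.id ∈ centralValuedSpan k A := by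
  constructor
  · rintro ⟨n, x, f, hx, hf⟩
    have hid : (LinearMap.id : Module.End k A) = ∑ i, LinearMap.mulLeft k (x i) ∘ₗ
        ((Algebra.linearMap (Subalgebra.center k A) A).comp (f i)).restrictScalars k := by
      ext y
      conv_lhs => rw [LinearMap.id_apply, ← hx y]
      simp [← Algebra.commutes, ← Algebra.smul_def]
    rw [hid]
    refine sum_mem fun i _ => Submodule.subset_span
      ⟨_, _, restrictScalars_mem_mulLeftRightSpan (hf i), fun y => ?_, rfl⟩
    simp [algebraMap_center_apply_s14]
  · intro h
    obtain ⟨n, c, g, hg⟩ := Submodule.mem_span_set'.mp h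
    choose x t ht hc hxt using fun i => (g i).2
    choose F hF hFt using fun i => exists_restrictScalars_eq (ht i)
    have hFt' : ∀ i y, F i y = t i y := fun i y => by rw [← hFt i]; rfl
    refine ⟨n, fun i => c i • x i, fun i =>
      { toFun := fun y => ⟨F i y, hFt' i y ▸ hc i y⟩
        map_add' := fun y z => Subtype.ext (map_add (F i) y z)
        map_smul' := fun r y => Subtype.ext (map_smul (F i) r y) }, fun y => ?_, fun i => ?_⟩
    · have := LinearMap.congr_fun hg y
      simp only [LinearMap.sum_apply, LinearMap.smul_apply, hxt, LinearMap.comp_apply,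
        LinearMap.mulLeft_apply, LinearMap.id_apply] at this
      conv_rhs => rw [← this]
      refine Finset.sum_congr rfl fun i _ => ?_
      show F i y * (c i • x i) = _
      rw [hFt', ← Subalgebra.mem_center_iff.mp (hc i y), smul_mul_assoc]
    · convert hF i using 1
      ext y
      exact algebraMap_center_apply_s14 k A _

theorem isAzumayaOverCenter_iff :
    IsAzumayaOverCenter k A ↔ LinearMap.id ∈ centralValuedSpan k A :=
  (isAzumayaOverCenter_iff_hasBimoduleDualBasis k A).trans hasBimoduleDualBasis_center_iff

theorem conj_mem_mulLeftRightSpan {B : Type} [Ring B] [Algebra k B] (e : A ≃ₐ[k] B)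
    {F : Module.End k A} (hF : F ∈ mulLeftRightSpan k A) :
    e.toLinearEquiv.conj F ∈ mulLeftRightSpan k B := by
  induction hF using mulLeftRightSpan_induction with
  | mul a b =>
    convert mulLeftRight_mem_mulLeftRightSpan (R := k) (e a) (e b) using 1
    ext x
    simp [LinearEquiv.conj_apply]
  | zero => simp
  | add F G _ _ hF hG => rw [map_add]; exact add_mem hF hG

theorem id_mem_centralValuedSpan_of_algEquiv {B : Type} [Ring B] [Algebra k B] (e : A ≃ₐ[k] B)
    (h : LinearMap.id ∈ centralValuedSpan k A) : LinearMap.id ∈ centralValuedSpan k B := by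
  have key : centralValuedSpan k A ≤
      (centralValuedSpan k B).comap e.toLinearEquiv.conj.toLinearMap := by
    refine Submodule.span_le.mpr ?_
    rintro _ ⟨x, t, ht, hc, rfl⟩
    refine Submodule.subset_span
      ⟨e x, _, conj_mem_mulLeftRightSpan e ht, fun y => ?_, ?_⟩
    · refine Subalgebra.mem_center_iff.mpr fun b => ?_
      have := congrArg e (Subalgebra.mem_center_iff.mp (hc (e.symm y)) (e.symm b))
      simpa [LinearEquiv.conj_apply] using this
    · ext y
      simp [LinearEquiv.conj_apply]
  simpa using key h

theorem baseChange_mem_centralValuedSpan (K : Type) [Field K] [Algebra k K]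
    {F : Module.End k A} (hF : F ∈ centralValuedSpan k A) :
    F.baseChange K ∈ centralValuedSpan K (K ⊗[k] A) := by
  induction hF using Submodule.span_induction with
  | mem F hF =>
    obtain ⟨x, t, ht, hc, rfl⟩ := hF
    refine Submodule.subset_span
      ⟨1 ⊗ₜ x, _, baseChange_mem_mulLeftRightSpan K ht, fun y => ?_, ?_⟩
    · induction y with
      | zero => simp
      | add y z hy hz => rw [map_add]; exact add_mem hy hz
      | tmul c y =>
        refine Subalgebra.mem_center_iff.mpr fun b => ?_
        induction b with
        | zero => simp
        | add b d hb hd => rw [add_mul, mul_add, hb, hd]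
        | tmul d b => simp [Subalgebra.mem_center_iff.mp (hc y) b, mul_comm]
    · ext y
      simp
  | zero => simp
  | add F G _ _ hF hG => rw [LinearMap.baseChange_add]; exact add_mem hF hG
  | smul c F _ hF =>
    rw [LinearMap.baseChange_smul, ← algebraMap_smul K c]
    exact Submodule.smul_mem _ _ hF

/-- Contraction of `K ⊗ A` to `A` along a linear functional on `K`. -/
def contractTensor {K : Type} [Field K] [Algebra k K] (l : K →ₗ[k] k) : K ⊗[k] A →ₗ[k] A :=
  (TensorProduct.lid k A).toLinearMap ∘ₗ l.rTensor A

@[simp]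
theorem contractTensor_tmul {K : Type} [Field K] [Algebra k K] (l : K →ₗ[k] k) (c : K) (a : A) :
    contractTensor l (c ⊗ₜ[k] a) = l c • a := by
  simp [contractTensor]

/-- The endomorphism of `A` obtained by contracting the values of an endomorphism of `K ⊗ A`
along a linear functional on `K`. -/
def contractEnd {K : Type} [Field K] [Algebra k K] (l : K →ₗ[k] k) :
    Module.End K (K ⊗[k] A) →ₗ[k] Module.End k A where
  toFun F := contractTensor l ∘ₗ F.restrictScalars k ∘ₗ TensorProduct.mk k K A 1
  map_add' F G := by ext; simp
  map_smul' c F := by ext; simp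

theorem contractEnd_apply {K : Type} [Field K] [Algebra k K] (l : K →ₗ[k] k)
    (F : Module.End K (K ⊗[k] A)) (y : A) :
    contractEnd l F y = contractTensor l (F (1 ⊗ₜ y)) := rfl

theorem contractTensor_mul_tmul {K : Type} [Field K] [Algebra k K] (l : K →ₗ[k] k) (w : K ⊗[k] A)
    (c : K) (a : A) :
    contractTensor l (w * c ⊗ₜ a) = contractTensor (l ∘ₗ LinearMap.mulLeft k c) w * a := by
  induction w with
  | zero => simp
  | add v w hv hw => simp [add_mul, hv, hw]
  | tmul d b => simp [mul_comm]

theorem contractTensor_tmul_mul {K : Type} [Field K] [Algebra k K] (l : K →ₗ[k] k) (w : K ⊗[k] A)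
    (c : K) (a : A) :
    contractTensor l (c ⊗ₜ a * w) = a * contractTensor (l ∘ₗ LinearMap.mulLeft k c) w := by
  induction w with
  | zero => simp
  | add v w hv hw => simp [mul_add, hv, hw]
  | tmul d b => simp

theorem contractTensor_mem_center {K : Type} [Field K] [Algebra k K] (l : K →ₗ[k] k)
    {w : K ⊗[k] A} (hw : w ∈ Subalgebra.center K (K ⊗[k] A)) :
    contractTensor l w ∈ Subalgebra.center k A := by
  refine Subalgebra.mem_center_iff.mpr fun a => ?_
  have := congrArg (contractTensor l) (Subalgebra.mem_center_iff.mp hw (1 ⊗ₜ a))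
  rw [contractTensor_mul_tmul, contractTensor_tmul_mul] at this
  simpa using this

theorem contractEnd_mem_mulLeftRightSpan {K : Type} [Field K] [Algebra k K] (l : K →ₗ[k] k)
    {F : Module.End K (K ⊗[k] A)} (hF : F ∈ mulLeftRightSpan K (K ⊗[k] A)) :
    contractEnd l F ∈ mulLeftRightSpan k A := by
  induction hF using mulLeftRightSpan_induction with
  | zero => simp
  | add F G _ _ hF hG => rw [map_add]; exact add_mem hF hG
  | mul u v =>
    have hu : ∀ u v : K ⊗[k] A, LinearMap.mulLeftRight K (u, v) =
        LinearMap.mul K _ u ∘ₗ (LinearMap.mul K _).flip v := by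
      intro u v; ext x; simp [mul_assoc]
    rw [hu]
    induction u with
    | zero => simp
    | add u w hu hw =>
      rw [map_add, LinearMap.add_comp, map_add]
      exact add_mem hu hw
    | tmul c a =>
      induction v with
      | zero => simp
      | add v w hv hw =>
        rw [map_add, LinearMap.comp_add, map_add]
        exact add_mem hv hw
      | tmul d b =>
        convert (mulLeftRightSpan k A).smul_mem (l (c * d))
          (mulLeftRight_mem_mulLeftRightSpan (R := k) a b) using 1
        ext y
        simp [contractEnd_apply, mul_assoc]

theorem contractEnd_mem_centralValuedSpan {K : Type} [Field K] [Algebra k K] (l : K →ₗ[k] k)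
    {F : Module.End K (K ⊗[k] A)} (hF : F ∈ centralValuedSpan K (K ⊗[k] A)) :
    contractEnd l F ∈ centralValuedSpan k A := by
  induction hF using Submodule.span_induction generalizing l with
  | zero => simp
  | add F G _ _ hF hG => rw [map_add]; exact add_mem (hF l) (hG l)
  | smul c F _ hF =>
    convert hF (l ∘ₗ LinearMap.mulLeft k c) using 1
    ext y
    have := contractTensor_tmul_mul l (F (1 ⊗ₜ y)) c 1
    rw [one_mul] at this
    rw [contractEnd_apply, contractEnd_apply, ← this, LinearMap.smul_apply]
    congr 1
    rw [← one_mul (F _), ← smul_mul_assoc, Algebra.TensorProduct.one_def,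
      TensorProduct.smul_tmul', smul_eq_mul, mul_one, ← Algebra.TensorProduct.one_def, one_mul]
  | mem F hF =>
    obtain ⟨x, t, ht, hc, rfl⟩ := hF
    induction x with
    | zero => simp
    | add x z hx hz =>
      have hadd : LinearMap.mulLeft K (x + z) ∘ₗ t =
          LinearMap.mulLeft K x ∘ₗ t + LinearMap.mulLeft K z ∘ₗ t := by
        ext
        simp [add_mul]
      rw [hadd, map_add]
      exact add_mem hx hz
    | tmul c x =>
      refine Submodule.subset_span
        ⟨x, _, contractEnd_mem_mulLeftRightSpan (l ∘ₗ LinearMap.mulLeft k c) ht,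
          fun y => contractTensor_mem_center _ (hc _), ?_⟩
      ext y
      simp [contractEnd_apply, contractTensor_tmul_mul]

theorem id_mem_centralValuedSpan_iff_baseChange (K : Type) [Field K] [Algebra k K] :
    LinearMap.id ∈ centralValuedSpan k A ↔
      LinearMap.id ∈ centralValuedSpan K (K ⊗[k] A) := by
  constructor
  · intro h
    simpa using baseChange_mem_centralValuedSpan K h
  · intro h
    obtain ⟨l, hl⟩ := Module.Projective.exists_dual_ne_zero k (one_ne_zero (α := K))
    convert (centralValuedSpan k A).smul_mem (l 1)⁻¹ (contractEnd_mem_centralValuedSpan l h) using 1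
    ext y
    simp [contractEnd_apply, smul_smul, hl]

theorem id_mem_centralValuedSpan_pi_matrix {s : ℕ} (n : Fin s → ℕ) (K : Fin s → Type)
    [∀ i, CommRing (K i)] [∀ i, Algebra k (K i)] :
    LinearMap.id ∈ centralValuedSpan k (∀ i, Matrix (Fin (n i)) (Fin (n i)) (K i)) := by
  classical
  let E (i : Fin s) (p q : Fin (n i)) : ∀ i, Matrix (Fin (n i)) (Fin (n i)) (K i) :=
    Pi.single i (Matrix.single p q 1)
  let t (i : Fin s) (p q : Fin (n i)) :
      Module.End k (∀ i, Matrix (Fin (n i)) (Fin (n i)) (K i)) :=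
    ∑ r, LinearMap.mulLeftRight k (E i r p, E i q r)
  have ht : ∀ i p q y, t i p q y = Pi.single i (Matrix.scalar (Fin (n i)) (y i p q)) := by
    intro i p q y
    funext j
    simp only [t, E, LinearMap.sum_apply, LinearMap.mulLeftRight_apply, Finset.sum_apply,
      Pi.mul_apply]
    rcases eq_or_ne i j with rfl | hij
    · simp only [Pi.single_eq_same, Matrix.single_mul_mul_single, one_mul, mul_one]
      exact Matrix.sum_single_eq_diagonal _
    · simp [Pi.single_eq_of_ne' hij]
  have hid : LinearMap.id = ∑ i, ∑ p, ∑ q, LinearMap.mulLeft k (E i p q) ∘ₗ t i p q := by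
    refine LinearMap.ext fun y => funext fun j => ?_
    simp only [LinearMap.sum_apply, LinearMap.comp_apply, LinearMap.mulLeft_apply, ht, E,
      Finset.sum_apply, Pi.mul_apply, LinearMap.id_apply]
    rw [Finset.sum_eq_single j]
    · conv_lhs => rw [Matrix.matrix_eq_sum_single (y j)]
      simp only [Pi.single_eq_same]
      refine Finset.sum_congr rfl fun p _ => Finset.sum_congr rfl fun q _ => ?_
      ext a b
      simp [Matrix.mul_diagonal, Matrix.single_apply]
    · intro i _ hij
      simp [Pi.single_eq_of_ne' hij]
    · simp
  rw [hid]
  refine sum_mem fun i _ => sum_mem fun p _ => sum_mem fun q _ => Submodule.subset_span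
    ⟨_, _, sum_mem fun r _ => mulLeftRight_mem_mulLeftRightSpan _ _, fun y => ?_, rfl⟩
  rw [show (∑ r, LinearMap.mulLeftRight k (E i r p, E i q r)) y = _ from ht i p q y]
  refine Subalgebra.mem_center_iff.mpr fun b => ?_
  funext j
  rcases eq_or_ne i j with rfl | hij
  · simp only [Pi.mul_apply, Pi.single_eq_same]
    exact (Matrix.scalar_commute _ (mul_comm _) _).symm
  · simp [Pi.single_eq_of_ne' hij]

end Center

section Splitting

variable {R A : Type} [CommRing R] [Ring A] [Algebra R A]

theorem HasBimoduleDualBasis.isSimpleRing {F B : Type} [Field F] [Ring B] [Algebra F B]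
    [Nontrivial B] (h : HasBimoduleDualBasis F B) : IsSimpleRing B := by
  refine ⟨⟨fun I => or_iff_not_imp_left.mpr fun hI => ?_⟩⟩
  obtain ⟨x, hxI, hx⟩ : ∃ x ∈ I, x ≠ 0 := by
    by_contra! hc
    exact hI (le_bot_iff.mp fun x hx => (TwoSidedIdeal.mem_bot _).mpr (hc x hx))
  obtain ⟨l, hl⟩ := Module.Projective.exists_dual_ne_zero F hx
  have hmem : ∀ G ∈ mulLeftRightSpan F B, G x ∈ I := by
    intro G hG
    induction hG using mulLeftRightSpan_induction with
    | mul a b => exact I.mul_mem_right _ _ (I.mul_mem_left _ _ hxI)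
    | zero => exact I.zero_mem
    | add G H _ _ hG hH => exact I.add_mem hG hH
  have h1 := hmem (l.smulRight ((l x)⁻¹ • (1 : B))) (h.mulLeftRightSpan_eq_top ▸ trivial)
  rw [LinearMap.smulRight_apply, smul_smul, mul_inv_cancel₀ hl, one_smul] at h1
  exact I.one_mem_iff.mp h1

/-- If `e` is an idempotent of `A` whose corner is spanned by `e` itself, and `R ∙ e` is a direct
summand of `A`, then `A` acts faithfully on `A * e`, as its full endomorphism ring. -/
theorem HasBimoduleDualBasis.nonempty_algEquiv_end (h : HasBimoduleDualBasis R A) {e : A}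
    (he : IsIdempotentElem e) (hcorner : ∀ a, ∃ r : R, e * a * e = r • e) {g : A →ₗ[R] R}
    (hg : g e = 1) :
    Nonempty (A ≃ₐ[R] Module.End R (LinearMap.range (LinearMap.mulRight R e))) := by
  let L := LinearMap.range (LinearMap.mulRight R e)
  have hmulL : ∀ a, ∀ x ∈ L, a * x ∈ L := by
    rintro a _ ⟨y, rfl⟩
    exact ⟨a * y, by simp [mul_assoc]⟩
  have hLe : ∀ x ∈ L, x * e = x := by
    rintro _ ⟨y, rfl⟩
    simp [mul_assoc, he.eq]
  let Φ : A →ₐ[R] Module.End R L := AlgHom.ofLinearMap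
    { toFun := fun a => (LinearMap.mulLeft R a).restrict (hmulL a)
      map_add' := fun a b => LinearMap.ext fun x => Subtype.ext (add_mul a b x)
      map_smul' := fun r a => LinearMap.ext fun x => Subtype.ext (smul_mul_assoc r a (x : A)) }
    (LinearMap.ext fun x => Subtype.ext (one_mul (x : A)))
    (fun a b => LinearMap.ext fun x => Subtype.ext (mul_assoc a b x))
  have hΦ : ∀ a (x : L), (Φ a x : A) = a * x := fun _ _ => rfl
  refine ⟨AlgEquiv.ofBijective Φ ⟨?_, ?_⟩⟩
  · refine (injective_iff_map_eq_zero Φ).mpr fun a ha => ?_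
    have hae : ∀ x, a * x * e = 0 := fun x => by
      have := congrArg Subtype.val (LinearMap.congr_fun ha ⟨x * e, x, rfl⟩)
      rw [hΦ] at this
      simpa [mul_assoc] using this
    obtain ⟨n, x, f, hx, hf⟩ := h
    have hzero : ∀ F ∈ mulLeftRightSpan R A, a * F e = 0 := by
      intro F hF
      induction hF using mulLeftRightSpan_induction with
      | mul c d => simp [← mul_assoc, hae]
      | zero => simp
      | add F G _ _ hF hG => simp [mul_add, hF, hG]
    have hfa : ∀ i, f i e • a = 0 := fun i => by
      rw [Algebra.smul_def, Algebra.commutes]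
      exact hzero _ (hf i)
    rw [← one_smul R a, ← hg, ← hx e, map_sum, Finset.sum_smul]
    refine Finset.sum_eq_zero fun i _ => ?_
    rw [map_smul, smul_eq_mul, mul_comm, mul_smul, hfa, smul_zero]
  · intro φ
    have hmain : ∀ F ∈ mulLeftRightSpan R A, ∃ a, ∀ x ∈ L, F x * e = a * x := by
      intro F hF
      induction hF using mulLeftRightSpan_induction with
      | mul c d =>
        obtain ⟨r, hr⟩ := hcorner d
        refine ⟨r • c, fun x hx => ?_⟩
        calc c * x * d * e = c * (x * (e * d * e)) := by
              conv_lhs => rw [← hLe x hx]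
              simp only [mul_assoc]
          _ = r • c * x := by rw [hr, mul_smul_comm, hLe x hx, mul_smul_comm, smul_mul_assoc]
      | zero => exact ⟨0, by simp⟩
      | add F G _ _ hF hG =>
        obtain ⟨a, ha⟩ := hF
        obtain ⟨b, hb⟩ := hG
        exact ⟨a + b, fun x hx => by simp [add_mul, ha x hx, hb x hx]⟩
    obtain ⟨a, ha⟩ := hmain (L.subtype ∘ₗ φ ∘ₗ (LinearMap.mulRight R e).rangeRestrict)
      (h.mulLeftRightSpan_eq_top ▸ trivial)
    refine ⟨a, ?_⟩
    ext x
    rw [hΦ, ← ha x x.2]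
    have hx : (LinearMap.mulRight R e).rangeRestrict (x : A) = x := Subtype.ext (hLe x x.2)
    simp only [LinearMap.comp_apply, hx, Submodule.subtype_apply]
    exact hLe _ (φ x).2

theorem isNilpotent_of_one_tmul_eq_zero [IsLocalRing R] [IsArtinianRing R] {a : A}
    (ha : (1 : IsLocalRing.ResidueField R) ⊗ₜ[R] a = 0) :
    a ∈ (IsLocalRing.maximalIdeal R • ⊤ : Submodule R A) ∧ IsNilpotent a := by
  have hmem : a ∈ (IsLocalRing.maximalIdeal R • ⊤ : Submodule R A) := by
    have := (LinearEquiv.map_eq_zero_iff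
      (TensorProduct.quotTensorEquivQuotSMul A (IsLocalRing.maximalIdeal R))
      (x := (1 : R ⧸ IsLocalRing.maximalIdeal R) ⊗ₜ[R] a)).mpr ha
    rwa [TensorProduct.quotTensorEquivQuotSMul_mk_one_tmul, Submodule.Quotient.mk_eq_zero] at this
  refine ⟨hmem, ?_⟩
  have hpow : ∀ n : ℕ, a ^ n ∈ (IsLocalRing.maximalIdeal R ^ n • ⊤ : Submodule R A) := by
    intro n
    induction n with
    | zero => simp
    | succ n ih =>
      rw [pow_succ a n, pow_succ' (IsLocalRing.maximalIdeal R) n, Submodule.mul_smul]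
      refine Submodule.smul_induction_on
        (p := fun x => a ^ n * x ∈ (IsLocalRing.maximalIdeal R •
          IsLocalRing.maximalIdeal R ^ n • ⊤ : Submodule R A)) hmem (fun r hr y _ => ?_)
        fun x y hx hy => by rw [mul_add]; exact add_mem hx hy
      have hy := Submodule.mem_map_of_mem (f := LinearMap.mulRight R y) ih
      rw [Submodule.map_smul''] at hy
      rw [mul_smul_comm]
      exact Submodule.smul_mem_smul hr (Submodule.smul_mono le_rfl le_top hy)
  obtain ⟨n, hn⟩ := IsArtinianRing.isNilpotent_jacobson_bot (R := R)
  rw [IsLocalRing.jacobson_eq_maximalIdeal ⊥ bot_ne_top] at hn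
  exact ⟨n, by simpa [hn] using hpow n⟩

theorem HasBimoduleDualBasis.exists_idempotent (F : Type) [Field F] [IsAlgClosed F] [Algebra F R]
    [FiniteDimensional F R] [IsLocalRing R] [Nontrivial A] (h : HasBimoduleDualBasis R A) :
    ∃ e : A, IsIdempotentElem e ∧ (∀ a, ∃ r : R, e * a * e = r • e) ∧
      ∃ g : A →ₗ[R] R, g e = 1 := by
  have := h.finite
  have := h.projective
  have : IsArtinianRing R := IsArtinianRing.of_finite F R
  have hfree : Module.Free R A := Module.free_of_flat_of_isLocalRing
  let κ := IsLocalRing.ResidueField R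
  have : Nontrivial (κ ⊗[R] A) := inferInstance
  have : IsSimpleRing (κ ⊗[R] A) := (h.baseChange κ).isSimpleRing
  have : FiniteDimensional F κ := Module.Finite.trans R κ
  have : FiniteDimensional F (κ ⊗[R] A) := Module.Finite.trans κ _
  obtain ⟨n, hn, ⟨Ψ⟩⟩ := IsSimpleRing.exists_algEquiv_matrix_of_isAlgClosed F (κ ⊗[R] A)
  let π : A →ₐ[R] κ ⊗[R] A := Algebra.TensorProduct.includeRight
  have hπ : Function.Surjective π := by
    intro u
    induction u with
    | zero => exact ⟨0, map_zero _⟩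
    | add u v hu hv =>
      obtain ⟨a, rfl⟩ := hu
      obtain ⟨b, rfl⟩ := hv
      exact ⟨a + b, map_add _ _ _⟩
    | tmul c a =>
      obtain ⟨r, rfl⟩ := IsLocalRing.residue_surjective c
      refine ⟨r • a, ?_⟩
      show (1 : κ) ⊗ₜ[R] (r • a) = _
      rw [← TensorProduct.smul_tmul, ← IsLocalRing.ResidueField.algebraMap_eq,
        Algebra.algebraMap_eq_smul_one]
  let ε : Matrix (Fin n) (Fin n) F := Matrix.single 0 0 1
  obtain ⟨e, he, heε⟩ := exists_isIdempotentElem_eq_of_ker_isNilpotent (π : A →+* κ ⊗[R] A)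
    (fun x hx => (isNilpotent_of_one_tmul_eq_zero hx).2) (Ψ.symm ε) (hπ _)
    (by
      show Ψ.symm ε * Ψ.symm ε = Ψ.symm ε
      rw [← map_mul]
      simp [ε])
  have heε' : π e = Ψ.symm ε := heε
  refine ⟨e, he, fun a => ?_, ?_⟩
  · let N := LinearMap.range (LinearMap.mulLeftRight R (e, e))
    have hN : N ≤ R ∙ e := by
      refine Submodule.le_of_le_smul_of_le_jacobson_bot (I := IsLocalRing.maximalIdeal R)
        (Module.Finite.iff_fg.mp inferInstance) (IsLocalRing.maximalIdeal_le_jacobson _) ?_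
      rintro _ ⟨a, rfl⟩
      let c : F := Ψ (π a) 0 0
      have hc : π (e * a * e - algebraMap F R c • e) = 0 := by
        have hcm : ε * Ψ (π a) * ε = c • ε := by
          simp [ε, c, Matrix.single_mul_mul_single]
        rw [map_sub, map_mul, map_mul, map_smul, heε', sub_eq_zero, algebraMap_smul]
        apply Ψ.injective
        rw [map_mul, map_mul, map_smul, AlgEquiv.apply_symm_apply, hcm]
      have hmem := Submodule.mem_map_of_mem (f := LinearMap.mulLeftRight R (e, e))
        (isNilpotent_of_one_tmul_eq_zero hc).1
      rw [Submodule.map_smul'', Submodule.map_top] at hmem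
      have heq : LinearMap.mulLeftRight R (e, e) a = algebraMap F R c • e +
          LinearMap.mulLeftRight R (e, e) (e * a * e - algebraMap F R c • e) := by
        have h2 : ∀ x, e * (e * x) = e * x := fun x => by rw [← mul_assoc, he.eq]
        simp [mul_sub, sub_mul, mul_assoc, he.eq, h2]
      rw [heq]
      exact Submodule.add_mem_sup (Submodule.smul_mem _ _ (Submodule.mem_span_singleton_self e))
        hmem
    obtain ⟨r, hr⟩ := Submodule.mem_span_singleton.mp (hN ⟨a, rfl⟩)
    exact ⟨r, by simpa using hr.symm⟩
  · let b := Module.Free.chooseBasis R A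
    obtain ⟨i, hi⟩ : ∃ i, IsUnit (b.repr e i) := by
      by_contra! hc
      have h0 : π e = 0 := by
        rw [← b.sum_repr e, map_sum]
        refine Finset.sum_eq_zero fun i _ => ?_
        show (1 : κ) ⊗ₜ[R] (b.repr e i • b i) = 0
        rw [← TensorProduct.smul_tmul, ← Algebra.algebraMap_eq_smul_one,
          IsLocalRing.ResidueField.algebraMap_eq,
          (IsLocalRing.residue_eq_zero_iff _).mpr ((IsLocalRing.mem_maximalIdeal _).mpr (hc i)),
          TensorProduct.zero_tmul]
      rw [heε', EmbeddingLike.map_eq_zero_iff] at h0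
      simpa [ε] using congrFun (congrFun h0 0) 0
    obtain ⟨r, hr⟩ := hi.exists_left_inv
    exact ⟨r • b.coord i, by simpa using hr⟩

theorem HasBimoduleDualBasis.exists_algEquiv_matrix (F : Type) [Field F] [IsAlgClosed F]
    [Algebra F R] [FiniteDimensional F R] [IsLocalRing R] [Nontrivial A]
    (h : HasBimoduleDualBasis R A) :
    ∃ n, 0 < n ∧ Nonempty (A ≃ₐ[R] Matrix (Fin n) (Fin n) R) := by
  have := h.finite
  have := h.projective
  obtain ⟨e, he, hcorner, g, hg⟩ := h.exists_idempotent F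
  obtain ⟨Φ⟩ := h.nonempty_algEquiv_end he hcorner hg
  let L := LinearMap.range (LinearMap.mulRight R e)
  have : Module.Projective R L := by
    refine Module.Projective.of_split L.subtype (LinearMap.mulRight R e).rangeRestrict ?_
    ext ⟨_, y, rfl⟩
    simp [mul_assoc, he.eq]
  have : Module.Free R L := Module.free_of_flat_of_isLocalRing
  let Ξ := Φ.trans (LinearMap.toMatrixAlgEquiv (Module.finBasis R L))
  refine ⟨_, Nat.pos_of_ne_zero fun h0 => ?_, ⟨Ξ⟩⟩
  have : IsEmpty (Fin (Module.finrank R L)) := by rw [h0]; infer_instance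
  exact not_subsingleton A Ξ.injective.subsingleton

end Splitting

section Decomposition

theorem exists_matrixAlgDecomp_of_isLocalRing (F : Type) {R A : Type} [Field F] [IsAlgClosed F]
    [CommRing R] [Algebra F R] [FiniteDimensional F R] [IsLocalRing R] [Ring A] [Algebra R A]
    [Algebra F A] [IsScalarTower F R A] (h : HasBimoduleDualBasis R A) :
    ∃ n, 0 < n ∧ Nonempty (MatrixAlgDecomp F A n) := by
  rcases subsingleton_or_nontrivial A with hA | hA
  · refine ⟨1, one_pos, ⟨⟨PUnit, inferInstance, ⟨AlgEquiv.ofBijective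
      (AlgHom.ofLinearMap 0 (Subsingleton.elim _ _) fun _ _ => Subsingleton.elim _ _)
      ⟨Function.injective_of_subsingleton _, fun y => ⟨0, Subsingleton.elim _ _⟩⟩⟩⟩⟩⟩
  · obtain ⟨n, hn, ⟨e⟩⟩ := h.exists_algEquiv_matrix F
    exact ⟨n, hn, ⟨⟨R, inferInstance, ⟨e.restrictScalars F⟩⟩⟩⟩

theorem bijective_pi_includeRight {R A ι : Type} [CommRing R] [Ring A] [Algebra R A]
    [Finite ι] (S : ι → Type) [∀ i, CommRing (S i)] [∀ i, Algebra R (S i)]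
    (hS : Function.Bijective (Algebra.ofId R (∀ i, S i))) :
    Function.Bijective
      (AlgHom.pi fun i => (Algebra.TensorProduct.includeRight : A →ₐ[R] S i ⊗[R] A)) := by
  classical
  have := Fintype.ofFinite ι
  let e := (TensorProduct.lid R A).symm ≪≫ₗ
    TensorProduct.congr (LinearEquiv.ofBijective (Algebra.ofId R (∀ i, S i)).toLinearMap hS)
      (LinearEquiv.refl R A) ≪≫ₗ TensorProduct.piLeft R A S
  convert e.bijective using 1
  funext a
  funext i
  show (1 : S i) ⊗ₜ[R] a = Algebra.ofId R (∀ i, S i) 1 i ⊗ₜ[R] a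
  rw [map_one, Pi.one_apply]

theorem HasBimoduleDualBasis.nonempty_matrixDecomp (F : Type) {R A : Type} [Field F]
    [IsAlgClosed F] [CommRing R] [Algebra F R] [FiniteDimensional F R] [Ring A] [Algebra R A]
    [Algebra F A] [IsScalarTower F R A] (h : HasBimoduleDualBasis R A) :
    Nonempty (MatrixDecomp F A) := by
  have : IsArtinianRing R := IsArtinianRing.of_finite F R
  let S (p : PrimeSpectrum R) : Type := Localization.AtPrime p.asIdeal
  have hS : Function.Bijective (Algebra.ofId R (∀ p, S p)) :=
    PrimeSpectrum.toPiLocalization_bijective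
  have hfin : ∀ p, FiniteDimensional F (S p) := fun p =>
    have := Module.Finite.of_surjective (Algebra.linearMap R (S p))
      (IsArtinianRing.localization_surjective p.asIdeal.primeCompl _)
    Module.Finite.trans R _
  choose n hn D using fun p : PrimeSpectrum R =>
    exists_matrixAlgDecomp_of_isLocalRing F (h.baseChange (S p))
  let D p := (D p).some
  let e := (AlgEquiv.ofBijective _ (bijective_pi_includeRight (A := A) S hS)).restrictScalars F
  have := Fintype.ofFinite (PrimeSpectrum R)
  let σ := (Fintype.equivFin (PrimeSpectrum R)).symm
  let := fun p => (D p).commRing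
  let := fun p => (D p).alg
  exact ⟨{
    s := Fintype.card (PrimeSpectrum R)
    n := fun i => n (σ i)
    npos := fun i => hn (σ i)
    K := fun i => (D (σ i)).K
    findim := fun i => (D (σ i)).findim
    iso := ⟨(e.trans (AlgEquiv.piCongrRight fun p => (D p).iso.some)).trans
      (AlgEquiv.piCongrLeft F (fun p => Matrix (Fin (n p)) (Fin (n p)) (D p).K) σ).symm⟩ }⟩

end Decomposition

/-- A finite-dimensional associative unital algebra `A` over a field `k` is
an Azumaya algebra over its center if and only if `A ⊗[k] k̄` is isomorphic, as a
`k̄`-algebra, to a finite direct product of matrix algebras over finite-dimensional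
commutative unital `k̄`-algebras. -/
theorem statement14 (k A : Type) [Field k] [Ring A] [Algebra k A] [FiniteDimensional k A] :
    IsAzumayaOverCenter k A ↔ IsMaximallyCentral k A := by
  rw [isAzumayaOverCenter_iff, id_mem_centralValuedSpan_iff_baseChange (AlgebraicClosure k)]
  constructor
  · intro h
    let B := AlgebraicClosure k ⊗[k] A
    let : Algebra (Subalgebra.center (AlgebraicClosure k) B) B := centerAlgebra_s14 _ B
    have : IsScalarTower (AlgebraicClosure k) (Subalgebra.center (AlgebraicClosure k) B) B :=
      ⟨fun c z b => smul_mul_assoc c (z : B) b⟩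
    exact (hasBimoduleDualBasis_center_iff.mpr h).nonempty_matrixDecomp (AlgebraicClosure k)
  · rintro ⟨D⟩
    let := D.commRing
    let := D.alg
    obtain ⟨e⟩ := D.iso
    exact id_mem_centralValuedSpan_of_algEquiv e.symm (id_mem_centralValuedSpan_pi_matrix D.n D.K)
end

section
/- Let A be a finite-dimensional associative unital algebra over a field k and n ≥ 1, and suppose that every simple quotient of A has dimension n² over its center. Then every simple quotient of A ⊗_k k̄ (k̄ an algebraic closure of k) has dimension n² over its center. -/
open TensorProduct

/-- In a simple ring `{0}` is a prime ideal. -/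
theorem IsSimpleRing.eq_zero_or_eq_zero_of_forall_mul_mul_eq_zero {R : Type*} [Ring R]
    [IsSimpleRing R] {x y : R} (h : ∀ r, x * r * y = 0) : x = 0 ∨ y = 0 := by
  by_contra! hxy
  let I : TwoSidedIdeal R := TwoSidedIdeal.mk' {z | ∀ r, z * r * y = 0} (by simp)
    (fun {a b} ha hb r ↦ by simp [add_mul, ha r, hb r])
    (fun {a} ha r ↦ by simp [ha r])
    (fun {a b} hb r ↦ by rw [mul_assoc a b r, mul_assoc a, hb r, mul_zero])
    (fun {a b} ha r ↦ by rw [mul_assoc a b r, ha])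
  have h1 : (1 : R) ∈ I :=
    one_mem_of_ne_zero_mem I hxy.1 (by simpa [I, TwoSidedIdeal.mem_mk'] using h)
  have h2 : ∀ r, (1 : R) * r * y = 0 := by
    simpa only [I, TwoSidedIdeal.mem_mk', Set.mem_ofPred_eq] using h1
  exact hxy.2 (by simpa using h2 1)

/-- A left Artinian prime ring is semisimple. -/
theorem IsSemisimpleRing.of_isArtinianRing_of_prime {R : Type*} [Ring R] [Nontrivial R]
    [IsArtinianRing R] (h : ∀ x y : R, (∀ r, x * r * y = 0) → x = 0 ∨ y = 0) :
    IsSemisimpleRing R := by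
  rw [IsArtinianRing.isSemisimpleRing_iff_jacobson]
  obtain ⟨m, hm⟩ := IsSemiprimaryRing.isNilpotent (R := R)
  induction m with
  | zero =>
    rw [Submodule.pow_zero, Ideal.one_eq_top] at hm
    exact absurd hm top_ne_bot
  | succ m ih =>
    by_contra hN
    obtain ⟨x, hx, hx0⟩ := Submodule.exists_mem_ne_zero_of_ne_bot hN
    obtain ⟨y, hy, hy0⟩ := Submodule.exists_mem_ne_zero_of_ne_bot (mt ih hN)
    rcases h x y fun r ↦ by
      have : x * (r * y) ∈ Ring.jacobson R * Ring.jacobson R ^ m :=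
        Ideal.mul_mem_mul hx (Ideal.mul_mem_left _ r hy)
      rw [← Ideal.IsTwoSided.pow_succ, hm] at this
      simpa [mul_assoc] using this with h0 | h0
    exacts [hx0 h0, hy0 h0]

/-- A left Artinian prime ring is simple. -/
theorem IsSimpleRing.of_isArtinianRing_of_prime {R : Type*} [Ring R] [Nontrivial R]
    [IsArtinianRing R] (h : ∀ x y : R, (∀ r, x * r * y = 0) → x = 0 ∨ y = 0) :
    IsSimpleRing R := by
  have := IsSemisimpleRing.of_isArtinianRing_of_prime h
  refine .of_eq_bot_or_eq_top fun J ↦ or_iff_not_imp_left.2 fun hJ ↦ ?_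
  obtain ⟨x, hxJ, hx0 : x ≠ 0⟩ := SetLike.exists_of_lt (bot_lt_iff_ne_bot.2 hJ)
  obtain ⟨L, hL⟩ := exists_isCompl (TwoSidedIdeal.asIdeal J)
  have hL0 : L = ⊥ := (Submodule.eq_bot_iff _).2 fun l hl ↦ by
    refine (h x l fun r ↦ ?_).resolve_left hx0
    have hmem : x * r * l ∈ TwoSidedIdeal.asIdeal J ⊓ L :=
      ⟨TwoSidedIdeal.mem_asIdeal.2 (J.mul_mem_right _ _ (J.mul_mem_right _ _ hxJ)),
        L.mul_mem_left _ hl⟩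
    simpa [hL.inf_eq_bot] using hmem
  have htop : TwoSidedIdeal.asIdeal J = ⊤ := by simpa [hL0] using hL.sup_eq_top
  rw [← J.one_mem_iff, ← TwoSidedIdeal.mem_asIdeal, htop]
  trivial

/-- Every module over a field is free. -/
theorem Module.Free.of_isField {R : Type*} [CommRing R] (hR : IsField R) (M : Type*)
    [AddCommGroup M] [Module R M] : Module.Free R M :=
  let _ : Field R := { ‹CommRing R›, hR.toField with }
  Module.Free.of_divisionRing R M

section CentralSimple

variable {Z F D C : Type*} [CommRing Z] [CommRing F] [Algebra Z F] [Ring D] [Algebra Z D]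
  [Algebra.IsCentral Z D] [IsSimpleRing D] [Ring C] [Nontrivial C]

/-- A tensor of minimal length argument: the kernel of a ring homomorphism out of `F ⊗[Z] D`
contains no nonzero `∑ i, c i ⊗ₜ d i` with the `c i` linearly independent. -/
theorem eq_zero_of_map_sum_tmul_eq_zero (hF : IsField F) (g : F ⊗[Z] D →+* C)
    {ι : Type*} {c : ι → F} (hc : LinearIndependent Z c) (s : Finset ι) :
    ∀ d : ι → D, g (∑ i ∈ s, c i ⊗ₜ d i) = 0 → ∀ i ∈ s, d i = 0 := by
  classical
  induction s using Finset.induction_on with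
  | empty => simp
  | insert j s hj ih =>
    intro d hd
    by_cases hdj : d j = 0
    · have hs := ih d (by simpa [Finset.sum_insert hj, hdj] using hd)
      simpa [hdj] using hs
    exfalso
    let I : TwoSidedIdeal D := TwoSidedIdeal.mk'
      {x | ∃ e : ι → D, e j = x ∧ g (∑ i ∈ insert j s, c i ⊗ₜ e i) = 0}
      ⟨0, by simp⟩
      (by
        rintro _ _ ⟨e, rfl, he⟩ ⟨e', rfl, he'⟩
        exact ⟨e + e', rfl, by
          simp only [Pi.add_apply, tmul_add, Finset.sum_add_distrib, map_add g, he, he', add_zero]⟩)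
      (by
        rintro _ ⟨e, rfl, he⟩
        exact ⟨-e, rfl, by
          simp only [Pi.neg_apply, tmul_neg, Finset.sum_neg_distrib, map_neg g, he, neg_zero]⟩)
      (by
        rintro x _ ⟨e, rfl, he⟩
        refine ⟨fun i ↦ x * e i, rfl, ?_⟩
        have := congrArg (g (1 ⊗ₜ x) * ·) he
        simpa only [← map_mul, Finset.mul_sum, Algebra.TensorProduct.tmul_mul_tmul, one_mul,
          mul_zero] using this)
      (by
        rintro _ x ⟨e, rfl, he⟩
        refine ⟨fun i ↦ e i * x, rfl, ?_⟩
        have := congrArg (· * g (1 ⊗ₜ x)) he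
        simpa only [← map_mul, Finset.sum_mul, Algebra.TensorProduct.tmul_mul_tmul, mul_one,
          zero_mul] using this)
    have h1 : (1 : D) ∈ I :=
      IsSimpleRing.one_mem_of_ne_zero_mem I hdj ((TwoSidedIdeal.mem_mk' ..).2 ⟨d, rfl, hd⟩)
    obtain ⟨e, hej, he⟩ := (TwoSidedIdeal.mem_mk' ..).1 h1
    have hcomm (x : D) : ∀ i ∈ s, x * e i - e i * x = 0 := by
      refine ih _ ?_
      have h1 := congrArg (g (1 ⊗ₜ x) * ·) he
      have h2 := congrArg (· * g (1 ⊗ₜ x)) he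
      simp only [← map_mul, Finset.mul_sum, Finset.sum_mul, Algebra.TensorProduct.tmul_mul_tmul,
        one_mul, mul_one, mul_zero, zero_mul] at h1 h2
      have h3 : g (∑ i ∈ insert j s, c i ⊗ₜ (x * e i - e i * x)) = 0 := by
        simp only [tmul_sub, Finset.sum_sub_distrib, map_sub g, h1, h2, sub_zero]
      simpa [Finset.sum_insert hj, hej] using h3
    have hz (i : ι) : ∃ z : Z, i ∈ insert j s → e i = algebraMap Z D z := by
      by_cases hi : i ∈ insert j s
      · obtain ⟨z, hz⟩ := (Algebra.IsCentral.mem_center_iff Z (x := e i)).1 <|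
          Subalgebra.mem_center_iff.2 fun x ↦ by
            rcases Finset.mem_insert.1 hi with rfl | hi
            · simp [hej]
            · exact sub_eq_zero.1 (hcomm x i hi)
        exact ⟨z, fun _ ↦ hz⟩
      · exact ⟨0, fun h ↦ absurd h hi⟩
    choose z hz using hz
    have hsum : ∑ i ∈ insert j s, c i ⊗ₜ[Z] e i = (∑ i ∈ insert j s, z i • c i) ⊗ₜ 1 := by
      rw [sum_tmul]
      refine Finset.sum_congr rfl fun i hi ↦ ?_
      rw [hz i hi, Algebra.algebraMap_eq_smul_one, smul_tmul]
    have hu : ∑ i ∈ insert j s, z i • c i ≠ 0 := fun h0 ↦ by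
      have hzj := linearIndependent_iff'.1 hc _ z h0 j (Finset.mem_insert_self j s)
      have := hz j (Finset.mem_insert_self j s)
      rw [hej, hzj, map_zero] at this
      exact one_ne_zero this
    rw [hsum] at he
    obtain ⟨v, hv⟩ := hF.mul_inv_cancel hu
    have := congrArg (· * g (v ⊗ₜ 1)) he
    simp only [← map_mul, Algebra.TensorProduct.tmul_mul_tmul, hv, mul_one, zero_mul,
      ← Algebra.TensorProduct.one_def, map_one] at this
    exact one_ne_zero this

/-- A ring homomorphism from the base change of a central simple algebra to a field is injective
if its codomain is nontrivial. -/
theorem injective_of_isCentral_of_isSimpleRing [Module.Free Z F] (hF : IsField F)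
    (g : F ⊗[Z] D →+* C) :
    Function.Injective g := by
  rw [injective_iff_map_eq_zero]
  intro t ht
  let b := Module.Free.chooseBasis Z F
  obtain ⟨d, rfl⟩ := (TensorProduct.equivFinsuppOfBasisLeft (N := D) b).symm.surjective t
  rw [TensorProduct.equivFinsuppOfBasisLeft_symm_apply, Finsupp.sum] at ht
  have hd := eq_zero_of_map_sum_tmul_eq_zero hF g b.linearIndependent d.support d ht
  have : d = 0 := Finsupp.ext fun i ↦ by
    by_contra hi
    exact hi (hd i (Finsupp.mem_support_iff.2 hi))
  rw [this, map_zero]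

/-- A nontrivial quotient of the base change of a central simple algebra has the same dimension. -/
theorem finrank_eq_of_surjective_of_isCentral [Module.Free Z F] [Module.Free Z D] [Nontrivial Z]
    [Algebra F C] (hF : IsField F) (g : F ⊗[Z] D →ₐ[F] C) (hg : Function.Surjective g) :
    Module.finrank F C = Module.finrank Z D := by
  have := hF.nontrivial
  rw [← Module.finrank_baseChange (R := F) (S := Z) (M' := D)]
  exact (LinearEquiv.ofBijective g.toLinearMap
    ⟨injective_of_isCentral_of_isSimpleRing hF g.toRingHom, hg⟩).finrank_eq.symm

end CentralSimple

/-- A ring as an algebra over its center. -/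
abbrev Subalgebra.algebraCenter (R A : Type*) [CommRing R] [Ring A] [Algebra R A] :
    Algebra (Subalgebra.center R A) A where
  algebraMap := ((Subalgebra.center R A).val : Subalgebra.center R A →+* A)
  commutes' z x := (Subalgebra.mem_center_iff.1 z.2 x).symm
  smul_def' _ _ := rfl

section Span

variable {k K C : Type*} [CommRing k] [CommRing K] [Ring C] [Algebra k C] [Algebra K C]
  {D : Subalgebra k C}

/-- An element commuting with a subring which spans over central scalars is central. -/
theorem mem_center_of_span_eq_top (hD : Submodule.span K (D : Set C) = ⊤) {x : C}
    (hx : ∀ y ∈ D, y * x = x * y) (c : C) : c * x = x * c := by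
  induction (hD ▸ Submodule.mem_top : c ∈ Submodule.span K (D : Set C))
    using Submodule.span_induction with
  | mem y hy => exact hx y hy
  | zero => simp
  | add a b _ _ ha hb => rw [add_mul, mul_add, ha, hb]
  | smul r a _ ha => rw [smul_mul_assoc, mul_smul_comm, ha]

/-- A subalgebra spanning a simple ring over central scalars is prime. -/
theorem eq_zero_or_eq_zero_of_span_eq_top [IsSimpleRing C]
    (hD : Submodule.span K (D : Set C) = ⊤) (x y : D) (h : ∀ r, x * r * y = 0) :
    x = 0 ∨ y = 0 := by
  have hC (c : C) : (x : C) * c * y = 0 := by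
    induction (hD ▸ Submodule.mem_top : c ∈ Submodule.span K (D : Set C))
      using Submodule.span_induction with
    | mem c hc => exact congrArg Subtype.val (h ⟨c, hc⟩)
    | zero => simp
    | add a b _ _ ha hb => rw [mul_add, add_mul, ha, hb, add_zero]
    | smul r a _ ha => rw [mul_smul_comm, smul_mul_assoc, ha, smul_zero]
  exact (IsSimpleRing.eq_zero_or_eq_zero_of_forall_mul_mul_eq_zero hC).imp
    Subtype.ext Subtype.ext

/-- If a simple subalgebra `D` spans the simple ring `C` over central scalars, then `C` and `D` have
the same dimension over their centers. -/
theorem finrank_center_eq_of_span_eq_top [IsSimpleRing C] [IsSimpleRing D]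
    (hD : Submodule.span K (D : Set C) = ⊤) :
    Module.finrank (Subalgebra.center K C) C = Module.finrank (Subalgebra.center k D) D := by
  have hF : IsField (Subalgebra.center K C) := IsSimpleRing.isField_center C
  have hZ : IsField (Subalgebra.center k D) := IsSimpleRing.isField_center D
  have := hZ.nontrivial
  let : Algebra (Subalgebra.center K C) C := Subalgebra.algebraCenter K C
  let : Algebra (Subalgebra.center k D) D := Subalgebra.algebraCenter k D
  let i : Subalgebra.center k D →+* Subalgebra.center K C :=
    ((D.val : D →+* C).comp ((Subalgebra.center k D).val : Subalgebra.center k D →+* D)).codRestrict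
      (Subalgebra.center K C) fun x ↦ Subalgebra.mem_center_iff.2 <|
        mem_center_of_span_eq_top hD fun y hy ↦
          congrArg Subtype.val (Subalgebra.mem_center_iff.1 x.2 ⟨y, hy⟩)
  let : Algebra (Subalgebra.center k D) (Subalgebra.center K C) := i.toAlgebra
  let : Algebra (Subalgebra.center k D) C :=
    ((algebraMap (Subalgebra.center K C) C).comp i).toAlgebra' fun z c ↦
      (Subalgebra.mem_center_iff.1 (i z).2 c).symm
  have := IsScalarTower.of_algebraMap_eq (R := Subalgebra.center k D)
    (S := Subalgebra.center K C) (A := C) fun _ ↦ rfl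
  have : Algebra.IsCentral (Subalgebra.center k D) D :=
    ⟨fun x hx ↦ ⟨⟨x, hx⟩, rfl⟩⟩
  let f : D →ₐ[Subalgebra.center k D] C := { (D.val : D →+* C) with commutes' := fun _ ↦ rfl }
  let g : Subalgebra.center K C ⊗[Subalgebra.center k D] D →ₐ[Subalgebra.center K C] C :=
    Algebra.TensorProduct.lift (Algebra.ofId _ _) f fun z d ↦
      (Subalgebra.mem_center_iff.1 z.2 (f d)).symm
  have := Module.Free.of_isField hZ (Subalgebra.center K C)
  have := Module.Free.of_isField hZ D
  refine finrank_eq_of_surjective_of_isCentral hF g fun c ↦ ?_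
  induction (hD ▸ Submodule.mem_top : c ∈ Submodule.span K (D : Set C))
    using Submodule.span_induction with
  | mem y hy =>
    refine ⟨1 ⊗ₜ ⟨y, hy⟩, (Algebra.TensorProduct.lift_tmul ..).trans ?_⟩
    rw [map_one, one_mul]
    rfl
  | zero => exact ⟨0, map_zero g⟩
  | add a b _ _ ha hb =>
    obtain ⟨a, rfl⟩ := ha
    obtain ⟨b, rfl⟩ := hb
    exact ⟨a + b, map_add g a b⟩
  | smul r a _ ha =>
    obtain ⟨a, rfl⟩ := ha
    refine ⟨algebraMap K (Subalgebra.center K C) r • a, ?_⟩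
    rw [map_smul, algebraMap_smul]

end Span

/-- Let `A` be a finite-dimensional associative unital algebra over a field
`k`, `n ≥ 1`, and suppose every simple quotient of `A` (i.e. every simple ring `B` which is
the image of a surjective `k`-algebra homomorphism `A → B`) has dimension `n²` over its
center.  Then every simple quotient of `A ⊗[k] k̄` has dimension `n²` over its center. -/
theorem statement15 (k A : Type) [Field k] [Ring A] [Algebra k A] [FiniteDimensional k A]
    (n : ℕ) (hn : 1 ≤ n)
    (hA : ∀ (B : Type) [Ring B] [Algebra k B] (π : A →ₐ[k] B), Function.Surjective π →
      IsSimpleRing B → Module.finrank (Subalgebra.center k B) B = n ^ 2) :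
    ∀ (C : Type) [Ring C] [Algebra (AlgebraicClosure k) C]
      (π : AlgebraicClosure k ⊗[k] A →ₐ[AlgebraicClosure k] C), Function.Surjective π →
      IsSimpleRing C →
        Module.finrank (Subalgebra.center (AlgebraicClosure k) C) C = n ^ 2 := by
  intro C _ _ π hπ _
  let : Algebra k C := Algebra.compHom C (algebraMap k (AlgebraicClosure k))
  have : IsScalarTower k (AlgebraicClosure k) C := .of_algebraMap_eq fun _ ↦ rfl
  let f : A →ₐ[k] C := (π.restrictScalars k).comp Algebra.TensorProduct.includeRight
  have hspan : Submodule.span (AlgebraicClosure k) (f.range : Set C) = ⊤ := by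
    refine Submodule.eq_top_iff'.2 fun c ↦ ?_
    obtain ⟨t, rfl⟩ := hπ c
    induction t with
    | zero => simp
    | add a b ha hb => rw [map_add]; exact add_mem ha hb
    | tmul x a =>
      have : π (x ⊗ₜ a) = x • f a := by
        simp [f, ← map_smul, smul_tmul']
      rw [this]
      exact Submodule.smul_mem _ _ (Submodule.subset_span ⟨a, rfl⟩)
  have hf := f.rangeRestrict_surjective
  have : FiniteDimensional k f.range := .of_surjective f.rangeRestrict.toLinearMap hf
  have : IsArtinianRing f.range := IsArtinianRing.of_finite k f.range
  have : IsSimpleRing f.range :=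
    .of_isArtinianRing_of_prime (eq_zero_or_eq_zero_of_span_eq_top hspan)
  rw [finrank_center_eq_of_span_eq_top hspan]
  exact hA f.range f.rangeRestrict hf inferInstance
end

section
/- Let A be a finite-dimensional associative unital algebra over an algebraically closed field k and n ≥ 1, and suppose that every simple quotient of A has dimension n² over its center. Then there exists a unital k-algebra K such that A ≅ M_n(K) as k-algebras. -/
/-- A presentation of an algebra `B` as a matrix algebra `M_n(K)` over a unital
`kb`-algebra `K`. -/
structure MatrixRingDecomp (kb : Type) [Field kb] (B : Type) [Ring B] [Algebra kb B]
    (n : ℕ) : Type 1 where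
  K : Type
  [ring : Ring K]
  [alg : Algebra kb K]
  iso : Nonempty (B ≃ₐ[kb] Matrix (Fin n) (Fin n) K)

/-- A full system of matrix units in a ring, indexed by a finite type. -/
structure IsMatrixUnits {ι R : Type*} [Fintype ι] [DecidableEq ι] [Ring R] (E : ι → ι → R) :
    Prop where
  mul_eq : ∀ i j k l, E i j * E k l = if j = k then E i l else 0
  sum_eq : ∑ i, E i i = 1

namespace IsMatrixUnits

variable {ι R S : Type*} [Fintype ι] [DecidableEq ι] [Ring R] [Ring S]

theorem completeOrthogonalIdempotents {E : ι → ι → R} (hE : IsMatrixUnits E) :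
    CompleteOrthogonalIdempotents fun i ↦ E i i where
  idem i := by simp [IsIdempotentElem, hE.mul_eq]
  ortho i j hij := by simp [hE.mul_eq, hij]
  complete := hE.sum_eq

theorem map {E : ι → ι → R} (hE : IsMatrixUnits E) (f : R →+* S) :
    IsMatrixUnits fun i j ↦ f (E i j) where
  mul_eq i j k l := by rw [← map_mul, hE.mul_eq, apply_ite f, map_zero]
  sum_eq := by rw [← map_sum, hE.sum_eq, map_one]

/-- Matrix units lift along surjections whose kernel consists of nilpotent elements. -/
theorem exists_lift [Nonempty ι] (f : R →+* S) (hf : Function.Surjective f)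
    (h : ∀ x ∈ RingHom.ker f, IsNilpotent x) {E : ι → ι → S} (hE : IsMatrixUnits E) :
    ∃ E' : ι → ι → R, IsMatrixUnits E' := by
  obtain ⟨o⟩ := ‹Nonempty ι›
  obtain ⟨p, hp, hpE⟩ := CompleteOrthogonalIdempotents.lift_of_isNilpotent_ker f h
    hE.completeOrthogonalIdempotents fun i ↦ hf _
  have hfp (i) : f (p i) = E i i := congrFun hpE i
  have idem (i) : p i * p i = p i := hp.idem i
  have key (i : ι) : ∃ a b : R, p i * a = a ∧ b * p i = b ∧ b * a = p o ∧ a * p o = a ∧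
      a * b = p i := by
    obtain ⟨x, hx⟩ := hf (E i o)
    obtain ⟨y, hy⟩ := hf (E o i)
    obtain ⟨a, ha⟩ : ∃ a, a = p i * x * p o := ⟨_, rfl⟩
    obtain ⟨b, hb⟩ : ∃ b, b = p o * y * p i := ⟨_, rfl⟩
    have pa : p i * a = a := by rw [ha, ← mul_assoc, ← mul_assoc, idem]
    have ap : a * p o = a := by rw [ha, mul_assoc, idem]
    have pb : p o * b = b := by rw [hb, ← mul_assoc, ← mul_assoc, idem]
    have bp : b * p i = b := by rw [hb, mul_assoc, idem]
    have fa : f a = E i o := by simp [ha, hfp, hx, hE.mul_eq]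
    have fb : f b = E o i := by simp [hb, hfp, hy, hE.mul_eq]
    have hu : b * a - p o ∈ RingHom.ker f := by simp [RingHom.mem_ker, fa, fb, hfp, hE.mul_eq]
    obtain ⟨v, hv⟩ := (h _ hu).isUnit_one_add
    have fv : f v = 1 := by rw [hv, map_add, (RingHom.mem_ker).1 hu, map_one, add_zero]
    have fv' : f (v⁻¹ : Rˣ) = 1 := by
      simpa [fv] using (map_mul f (v : R) (v⁻¹ : Rˣ)).symm
    have hba : b * a = v * p o := by
      rw [hv, add_mul, sub_mul, mul_assoc, ap, idem]; simp
    have hc : p o * (v⁻¹ : Rˣ) * b * a = p o := by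
      rw [mul_assoc, hba, mul_assoc, Units.inv_mul_cancel_left, idem]
    refine ⟨a, p o * (v⁻¹ : Rˣ) * b, pa, by rw [mul_assoc, bp], hc, ap, ?_⟩
    obtain ⟨c, hcdef⟩ : ∃ c, c = p o * (v⁻¹ : Rˣ) * b := ⟨_, rfl⟩
    rw [← hcdef] at hc ⊢
    have cp : c * p i = c := by rw [hcdef, mul_assoc, bp]
    have fc : f c = E o i := by simp [hcdef, fv', fb, hfp, hE.mul_eq]
    have hacac : a * c * (a * c) = a * c := by
      rw [mul_assoc, ← mul_assoc c, hc, ← mul_assoc, ap]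
    have hq : IsIdempotentElem (p i - a * c) := by
      rw [IsIdempotentElem, mul_sub, sub_mul, sub_mul, idem, hacac, ← mul_assoc, pa, mul_assoc, cp]
      abel
    have hn : IsNilpotent (p i - a * c) :=
      h _ (by simp [RingHom.mem_ker, fa, fc, hfp, hE.mul_eq])
    obtain ⟨m, hm⟩ := hn
    have h0 : p i - a * c = 0 := by
      have := hq.pow_succ_eq m
      rw [pow_succ, hm, zero_mul] at this
      exact this.symm
    exact (sub_eq_zero.1 h0).symm
  choose a b pa bp ba ap ab using key
  refine ⟨fun i j ↦ a i * b j, ⟨fun i j k l ↦ ?_, by simp_rw [ab]; exact hp.complete⟩⟩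
  have hba : b j * a k = if j = k then p o else 0 := by
    split_ifs with hjk
    · rw [← hjk, ba]
    · rw [← bp j, ← pa k, mul_assoc, ← mul_assoc (p j), hp.ortho hjk, zero_mul, mul_zero]
  rw [mul_assoc, ← mul_assoc (b j), hba]
  split_ifs
  · rw [← mul_assoc, ap]
  · simp

/-- A `k`-algebra with a full system of matrix units is a matrix algebra over the centralizer of
the matrix units. -/
theorem nonempty_algEquiv_matrix (k : Type*) [Field k] [Algebra k R] {E : ι → ι → R}
    (hE : IsMatrixUnits E) :
    Nonempty (R ≃ₐ[k] Matrix ι ι (Subalgebra.centralizer k {x | ∃ i j, E i j = x})) := by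
  set K := Subalgebra.centralizer k {x | ∃ i j, E i j = x}
  have comm (c : K) (i j : ι) : E i j * c = c * E i j :=
    Subalgebra.mem_centralizer_iff k |>.1 c.2 _ ⟨i, j, rfl⟩
  let g : Matrix ι ι K →ₗ[k] R :=
    { toFun M := ∑ i, ∑ j, (M i j : R) * E i j
      map_add' M N := by simp [add_mul, Finset.sum_add_distrib]
      map_smul' c M := by simp [Finset.smul_sum] }
  have hg (M) : g M = ∑ i, ∑ j, (M i j : R) * E i j := rfl
  have g_one : g 1 = 1 := by
    rw [hg, ← hE.sum_eq]
    refine Finset.sum_congr rfl fun i _ ↦ ?_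
    rw [Finset.sum_eq_single i] <;> simp +contextual [eq_comm]
  have g_mul (M N) : g (M * N) = g M * g N := by
    have mul_aux (i j p q : ι) : (M i j : R) * E i j * ((N p q : R) * E p q) =
        if j = p then (M i j : R) * N p q * E i q else 0 := by
      rw [mul_assoc, ← mul_assoc (E i j), comm, mul_assoc _ (E i j), hE.mul_eq]
      split_ifs <;> simp [mul_assoc]
    have mul_row (i j : ι) : (M i j : R) * E i j * g N =
        ∑ q, (M i j : R) * N j q * E i q := by
      simp only [hg, Finset.mul_sum, mul_aux]
      rw [Finset.sum_comm]
      simp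
    rw [hg M, Finset.sum_mul, hg]
    simp only [Finset.sum_mul, mul_row, Matrix.mul_apply, AddSubmonoidClass.coe_finsetSum,
      MulMemClass.coe_mul]
    exact Finset.sum_congr rfl fun i _ ↦ Finset.sum_comm
  let G : Matrix ι ι K →ₐ[k] R := AlgHom.ofLinearMap g g_one g_mul
  refine ⟨(AlgEquiv.ofBijective G ⟨?_, fun x ↦ ?_⟩).symm⟩
  · refine (injective_iff_map_eq_zero G).2 fun M hM ↦ ?_
    ext i j
    have sandwich (p q l : ι) : E l i * ((M p q : R) * E p q) * E j l =
        if i = p then (if q = j then (M p q : R) * E l l else 0) else 0 := by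
      rw [← mul_assoc, comm, mul_assoc, mul_assoc, ← mul_assoc (E l i), hE.mul_eq]
      split_ifs <;> simp_all [hE.mul_eq]
    have h0 : ∑ l, E l i * g M * E j l = (M i j : R) := by
      simp only [hg, Finset.mul_sum, Finset.sum_mul, sandwich]
      simp [← Finset.mul_sum, hE.sum_eq]
    rw [← h0, show g M = 0 from hM]
    simp
  · have mem (i j) : ∑ l, E l i * x * E j l ∈ K := by
      rw [Subalgebra.mem_centralizer_iff]
      rintro _ ⟨p, q, rfl⟩
      simp only [Finset.mul_sum, Finset.sum_mul, ← mul_assoc, hE.mul_eq]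
      simp [mul_assoc, hE.mul_eq]
    refine ⟨Matrix.of fun i j ↦ ⟨_, mem i j⟩, ?_⟩
    change g _ = x
    rw [hg]
    calc _ = ∑ i, ∑ j, E i i * x * E j j := by
          simp [Finset.sum_mul, mul_assoc, hE.mul_eq]
      _ = x := by
          simp_rw [← Finset.mul_sum, hE.sum_eq, ← Finset.sum_mul, hE.sum_eq]; simp

end IsMatrixUnits

theorem Matrix.isMatrixUnits_single (ι R : Type*) [Fintype ι] [DecidableEq ι] [Ring R] :
    IsMatrixUnits fun i j : ι ↦ Matrix.single i j (1 : R) where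
  mul_eq i j k l := by split_ifs with h <;> simp [h]
  sum_eq := Matrix.sum_single_one

theorem Matrix.finrank_center (d : ℕ) [NeZero d] (k : Type*) [Field k] :
    Module.finrank (Subalgebra.center k (Matrix (Fin d) (Fin d) k)) (Matrix (Fin d) (Fin d) k) =
      d ^ 2 := by
  have hbij : Function.Bijective
      (algebraMap k (Subalgebra.center k (Matrix (Fin d) (Fin d) k))) := by
    rw [Algebra.IsCentral.center_eq_bot]
    exact (Algebra.botEquiv k (Matrix (Fin d) (Fin d) k)).symm.bijective
  have h := congrArg Cardinal.toNat <|
    rank_eq_of_equiv_equiv _ (AddEquiv.refl (Matrix (Fin d) (Fin d) k)) hbij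
      fun r m ↦ (algebraMap_smul _ r m).symm
  rw [Module.finrank, ← h, ← Module.finrank, Module.finrank_matrix]
  simp [sq]

/-- Let `A` be a finite-dimensional associative unital algebra over an
algebraically closed field `k`, `n ≥ 1`, and suppose every simple quotient of `A` has
dimension `n²` over its center.  Then `A ≅ M_n(K)` for some unital `k`-algebra `K`. -/
theorem statement16 (k A : Type) [Field k] [IsAlgClosed k] [Ring A] [Algebra k A]
    [FiniteDimensional k A] (n : ℕ) (hn : 1 ≤ n)
    (hA : ∀ (B : Type) [Ring B] [Algebra k B] (π : A →ₐ[k] B), Function.Surjective π →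
      IsSimpleRing B → Module.finrank (Subalgebra.center k B) B = n ^ 2) :
    Nonempty (MatrixRingDecomp k A n) := by
  have : NeZero n := ⟨by omega⟩
  have : IsArtinianRing A := IsArtinianRing.of_finite k A
  have : FiniteDimensional k (A ⧸ Ring.jacobson A) :=
    Module.Finite.of_surjective (Ideal.Quotient.mkₐ k (Ring.jacobson A)).toLinearMap
      Ideal.Quotient.mk_surjective
  obtain ⟨m, d, hd, ⟨e⟩⟩ :=
    IsSemisimpleRing.exists_algEquiv_pi_matrix_of_isAlgClosed k (A ⧸ Ring.jacobson A)
  let f : A →ₐ[k] Π i, Matrix (Fin (d i)) (Fin (d i)) k :=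
    e.toAlgHom.comp (Ideal.Quotient.mkₐ k (Ring.jacobson A))
  have hf : Function.Surjective f := e.surjective.comp Ideal.Quotient.mk_surjective
  have hdn (i) : d i = n := by
    have := hd i
    have h := hA _ ((Pi.evalAlgHom k _ i).comp f) ((Function.surjective_eval i).comp hf)
      inferInstance
    rw [Matrix.finrank_center] at h
    exact Nat.pow_left_injective two_ne_zero h
  obtain rfl : d = fun _ ↦ n := funext hdn
  have hker : ∀ x ∈ RingHom.ker f.toRingHom, IsNilpotent x := fun x hx ↦ by
    have hx : x ∈ Ring.jacobson A := by
      rw [← Ideal.Quotient.eq_zero_iff_mem]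
      exact (map_eq_zero_iff e e.injective).1 hx
    obtain ⟨N, hN⟩ := IsSemiprimaryRing.isNilpotent (R := A)
    exact ⟨N, by simpa [hN] using Ideal.pow_mem_pow hx N⟩
  have hE : IsMatrixUnits fun (i j : Fin n) (_ : Fin m) ↦ Matrix.single i j (1 : k) :=
    (Matrix.isMatrixUnits_single (Fin n) k).map (Pi.constRingHom _ _)
  obtain ⟨E, hE'⟩ := hE.exists_lift f.toRingHom hf hker
  exact ⟨{ K := _, iso := hE'.nonempty_algEquiv_matrix k }⟩
end

section
/- Let p be a prime, F = 𝔽_p(t) the field of rational functions over the field with p elements, and k = 𝔽_p(t^p) the subfield of F generated by t^p (so F/k is a purely inseparable extension of degree p). Then the base-change homomorphism Br(k) → Br(F) of Brauer groups, induced by extension of scalars from k to F, sends every element of order dividing p to the identity; that is, it annihilates the p-torsion of Br(k). -/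
open scoped TensorProduct

section BaseChange

variable {k D : Type*} [Field k] [Ring D] [Algebra k D]

theorem AlgHom.mulLeftRight_surjective_of_isCentral_of_isSimpleRing [Algebra.IsCentral k D]
    [IsSimpleRing D] [FiniteDimensional k D] :
    Function.Surjective (AlgHom.mulLeftRight k D) := by
  intro f
  let _ : Module (D ⊗[k] Dᵐᵒᵖ) D := Module.compHom D (AlgHom.mulLeftRight k D).toRingHom
  have smul_def (r : D ⊗[k] Dᵐᵒᵖ) (x : D) : r • x = AlgHom.mulLeftRight k D r x := rfl
  have : IsSimpleModule (D ⊗[k] Dᵐᵒᵖ) D := by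
    refine (isSimpleModule_iff ..).mpr { eq_bot_or_eq_top := fun N ↦ ?_ }
    let I : TwoSidedIdeal D := .mk' N N.zero_mem N.add_mem N.neg_mem
      (fun {x y} hy ↦ by simpa [smul_def] using N.smul_mem (x ⊗ₜ 1) hy)
      (fun {x y} hx ↦ by simpa [smul_def] using N.smul_mem (1 ⊗ₜ .op y) hx)
    have hI (x : D) : x ∈ I ↔ x ∈ N := TwoSidedIdeal.mem_mk' ..
    refine (eq_bot_or_eq_top I).imp (fun h ↦ ?_) (fun h ↦ ?_)
    · ext x; simp [← hI, h, TwoSidedIdeal.mem_bot]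
    · ext x; simp [← hI, h]
  have hscalar (e : Module.End (D ⊗[k] Dᵐᵒᵖ) D) : ∃ c : k, ∀ x, e x = c • x := by
    have hl (x : D) : e x = x * e 1 := by
      simpa [smul_def] using e.map_smul (x ⊗ₜ 1) 1
    have hr (x : D) : e x = e 1 * x := by
      simpa [smul_def] using e.map_smul (1 ⊗ₜ .op x) 1
    obtain ⟨c, hc⟩ := (Algebra.IsCentral.mem_center_iff k).mp
      (Subalgebra.mem_center_iff.mpr fun x ↦ (hl x).symm.trans (hr x) : e 1 ∈ Subalgebra.center k D)
    exact ⟨c, fun x ↦ by rw [hr, hc, Algebra.smul_def]⟩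
  let g : Module.End (Module.End (D ⊗[k] Dᵐᵒᵖ) D) D :=
    { toFun := f
      map_add' := f.map_add
      map_smul' := fun e x ↦ by
        obtain ⟨c, hc⟩ := hscalar e
        simp [Module.End.smul_def, hc] }
  let b := Module.finBasis k D
  classical
  obtain ⟨r, hr⟩ := jacobson_density g (Finset.univ.image b)
  exact ⟨r, b.ext fun i ↦ (hr (b i) (by simp)).symm⟩

variable (K : Type*) [Field K] [Algebra k K]

theorem TwoSidedIdeal.baseChange_mulLeftRight_mem (I : TwoSidedIdeal (K ⊗[k] D))
    (r : D ⊗[k] Dᵐᵒᵖ) {x : K ⊗[k] D} (hx : x ∈ I) :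
    (AlgHom.mulLeftRight k D r).baseChange K x ∈ I := by
  induction r with
  | zero => simp
  | add r s hr hs => simpa [LinearMap.baseChange_add] using I.add_mem hr hs
  | tmul a b =>
    have : (AlgHom.mulLeftRight k D (a ⊗ₜ b)).baseChange K x = (1 ⊗ₜ a) * x * (1 ⊗ₜ b.unop) := by
      clear hx
      induction x with
      | zero => simp
      | add x y hx hy => simp [mul_add, add_mul, hx, hy]
      | tmul c d => simp
    exact this ▸ I.mul_mem_right _ _ (I.mul_mem_left _ _ hx)

theorem Subalgebra.baseChange_mulLeftRight_of_mem_center (r : D ⊗[k] Dᵐᵒᵖ) {x : K ⊗[k] D}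
    (hx : x ∈ Subalgebra.center K (K ⊗[k] D)) :
    (AlgHom.mulLeftRight k D r).baseChange K x = x * (1 ⊗ₜ AlgHom.mulLeftRight k D r 1) := by
  induction r with
  | zero => simp
  | add r s hr hs => simp [LinearMap.baseChange_add, hr, hs, TensorProduct.tmul_add, mul_add]
  | tmul a b =>
    have : (AlgHom.mulLeftRight k D (a ⊗ₜ b)).baseChange K x = (1 ⊗ₜ a) * x * (1 ⊗ₜ b.unop) := by
      clear hx
      induction x with
      | zero => simp
      | add x y hx hy => simp [mul_add, add_mul, hx, hy]
      | tmul c d => simp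
    rw [this, Subalgebra.mem_center_iff.mp hx, mul_assoc]
    simp

variable [Algebra.IsCentral k D] [IsSimpleRing D] [FiniteDimensional k D]

theorem IsSimpleRing.baseChange : IsSimpleRing (K ⊗[k] D) := by
  refine .of_eq_bot_or_eq_top fun I ↦ or_iff_not_imp_left.mpr fun hI ↦ ?_
  obtain ⟨x, hxI, hx⟩ : ∃ x ∈ I, x ≠ 0 := by
    by_contra! h
    exact hI (eq_bot_iff.mpr fun x hx ↦ by simpa [TwoSidedIdeal.mem_bot] using h x hx)
  let b := Module.finBasis k D
  let B := b.baseChange K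
  obtain ⟨j, hj⟩ : ∃ j, B.repr x j ≠ 0 := by
    by_contra! h
    exact hx (B.repr.map_eq_zero_iff.mp (Finsupp.ext h))
  obtain ⟨r, hr⟩ := AlgHom.mulLeftRight_surjective_of_isCentral_of_isSimpleRing
    (b.constr k fun i ↦ if i = j then (1 : D) else 0)
  have hmem := I.baseChange_mulLeftRight_mem K r hxI
  have hval : (AlgHom.mulLeftRight k D r).baseChange K x = B.repr x j ⊗ₜ 1 := by
    conv_lhs => rw [← B.sum_repr x]
    rw [hr]
    simp [B, b.constr_basis, TensorProduct.smul_tmul', TensorProduct.tmul_ite]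
  rw [hval] at hmem
  have := I.mul_mem_left ((B.repr x j)⁻¹ ⊗ₜ 1) _ hmem
  rw [Algebra.TensorProduct.tmul_mul_tmul, inv_mul_cancel₀ hj, mul_one,
    ← Algebra.TensorProduct.one_def] at this
  exact I.one_mem_iff.mp this

theorem Algebra.IsCentral.baseChange : Algebra.IsCentral K (K ⊗[k] D) := by
  refine ⟨fun x hx ↦ ?_⟩
  obtain ⟨φ, hφ⟩ := LinearMap.exists_leftInverse_of_injective (Algebra.linearMap k D)
    (LinearMap.ker_eq_bot.mpr (FaithfulSMul.algebraMap_injective k D))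
  obtain ⟨r, hr⟩ := AlgHom.mulLeftRight_surjective_of_isCentral_of_isSimpleRing
    (Algebra.linearMap k D ∘ₗ φ)
  have hφ1 : φ 1 = 1 := by simpa using congr($hφ 1)
  have h := Subalgebra.baseChange_mulLeftRight_of_mem_center K r hx
  rw [hr, LinearMap.comp_apply, hφ1, Algebra.linearMap_apply, map_one,
    ← Algebra.TensorProduct.one_def, mul_one] at h
  rw [← h, LinearMap.baseChange_comp, LinearMap.comp_apply]
  generalize φ.baseChange K x = y
  induction y with
  | zero => simp
  | add x y hx hy => rw [map_add]; exact add_mem hx hy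
  | tmul c d =>
    refine Algebra.mem_bot.mpr ⟨d • c, ?_⟩
    simp [Algebra.algebraMap_eq_smul_one, Algebra.TensorProduct.one_def, TensorProduct.smul_tmul']

end BaseChange

section SepClosed

variable (K : Type*) [Field K] [IsSepClosed K]

theorem IsSepClosed.algebraMap_bijective_of_isCentral_divisionRing (Δ : Type*) [DivisionRing Δ]
    [Algebra K Δ] [FiniteDimensional K Δ] [Algebra.IsCentral K Δ] :
    Function.Bijective (algebraMap K Δ) := by
  refine ⟨FaithfulSMul.algebraMap_injective K Δ, ?_⟩
  by_contra h
  obtain ⟨x, hx, hsep⟩ := JacobsonNoether.exists_separable_and_not_isCentral' (L := K) (D := Δ)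
    (fun h' ↦ h (Algebra.surjective_algebraMap_iff.mpr h'.symm))
  refine hx (Algebra.mem_bot.mpr (minpoly.mem_range_of_degree_eq_one K x ?_))
  exact degree_eq_one_of_irreducible K (minpoly.irreducible (Algebra.IsIntegral.isIntegral x)) hsep

theorem IsSepClosed.exists_algEquiv_matrix_of_isCentral_of_isSimpleRing (R : Type*) [Ring R]
    [Algebra K R] [FiniteDimensional K R] [IsSimpleRing R] [Algebra.IsCentral K R] :
    ∃ (n : ℕ) (_ : NeZero n), Nonempty (R ≃ₐ[K] Matrix (Fin n) (Fin n) K) := by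
  have := IsArtinianRing.of_finite K R
  obtain ⟨n, hn, Δ, _, _, _, ⟨e⟩⟩ := IsSimpleRing.exists_algEquiv_matrix_divisionRing_finite K R
  have : Algebra.IsCentral K Δ := by
    have := Algebra.IsCentral.of_algEquiv K _ _ e
    refine ⟨fun x hx ↦ ?_⟩
    have hc : Matrix.scalar (Fin n) x ∈ Subalgebra.center K (Matrix (Fin n) (Fin n) Δ) := by
      rw [Subalgebra.mem_center_iff] at hx ⊢
      exact fun M ↦ ((Matrix.scalar_commute x (fun y ↦ (hx y).symm) M)).symm
    obtain ⟨c, hc⟩ := (Algebra.IsCentral.mem_center_iff K).mp hc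
    refine Algebra.mem_bot.mpr ⟨c, ?_⟩
    simpa [Matrix.algebraMap_matrix_apply] using congr($hc 0 0).symm
  exact ⟨n, hn, ⟨e.trans <| .mapMatrix <| .symm <| .ofBijective (Algebra.ofId K Δ)
    (algebraMap_bijective_of_isCentral_divisionRing K Δ)⟩⟩

end SepClosed

section Rotation

variable {p : ℕ} [NeZero p] {X : Type*}

/-- Rotation of a word of length `p` by `i`. -/
def rotateWord (i : Fin p) : (Fin p → X) ≃ (Fin p → X) :=
  (Equiv.subRight i).arrowCongr (Equiv.refl X)

theorem rotateWord_apply (i : Fin p) (x : Fin p → X) (j : Fin p) :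
    rotateWord i x j = x (j + i) := by
  simp [rotateWord]

@[simp]
theorem rotateWord_zero (x : Fin p → X) : rotateWord 0 x = x := by
  ext j; simp [rotateWord_apply]

theorem rotateWord_rotateWord (i j : Fin p) (x : Fin p → X) :
    rotateWord i (rotateWord j x) = rotateWord (i + j) x := by
  ext l; simp [rotateWord_apply, add_assoc]

@[simp]
theorem rotateWord_const (i : Fin p) (a : X) : rotateWord i (fun _ ↦ a) = fun _ ↦ a := by
  ext l; simp [rotateWord_apply]

theorem exists_eq_const_of_rotateWord_eq [hp : Fact p.Prime] {i : Fin p} (hi : i ≠ 0)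
    {x : Fin p → X} (hx : rotateWord i x = x) : ∃ a, x = fun _ ↦ a := by
  have hn (n : ℕ) : x (n • i) = x 0 := by
    induction n with
    | zero => simp
    | succ n ih => rw [succ_nsmul, ← ih]; exact (rotateWord_apply i x _).symm.trans (congr_fun hx _)
  refine ⟨x 0, funext fun j ↦ ?_⟩
  obtain ⟨n, rfl⟩ := mem_multiples_of_prime_card (p := p) (by simp) hi (g' := j)
  exact hn n

/-- The words of prime length which are not constant are, up to unique rotation, given by
a finite set. -/
theorem exists_sum_words_eq [hp : Fact p.Prime] (X M : Type*) [Fintype X] [DecidableEq X]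
    [AddCommMonoid M] :
    ∃ T : Finset (Fin p → X), ∀ f : (Fin p → X) → M,
      ∑ x, f x = ∑ a, f (fun _ ↦ a) + ∑ i : Fin p, ∑ x ∈ T, f (rotateWord i x) := by
  classical
  let rk := Fintype.equivFin (Fin p → X)
  let C : Finset (Fin p → X) := Finset.univ.image fun a _ ↦ a
  have hC (x : Fin p → X) : x ∈ C ↔ ∃ a, x = fun _ ↦ a := by simp [C, eq_comm]
  have hCr {i : Fin p} {x : Fin p → X} (h : rotateWord i x ∈ C) : x ∈ C := by
    obtain ⟨a, ha⟩ := (hC _).mp h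
    exact (hC _).mpr ⟨a, (rotateWord i).injective (by simp [ha])⟩
  refine ⟨Cᶜ.filter fun x ↦ ∀ i, rk x ≤ rk (rotateWord i x), fun f ↦ ?_⟩
  rw [← Finset.sum_add_sum_compl C, Finset.sum_image (fun a _ b _ h ↦ congr_fun h 0),
    ← Finset.sum_product']
  congr 1
  symm
  refine Finset.sum_bij (fun q _ ↦ rotateWord q.1 q.2) ?_ ?_ ?_ (fun _ _ ↦ rfl)
  · rintro ⟨i, x⟩ h
    simp only [Finset.mem_product, Finset.mem_filter, Finset.mem_compl] at h ⊢
    exact fun h' ↦ h.2.1 (hCr h')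
  · rintro ⟨i, x⟩ h ⟨j, y⟩ h' e
    simp only [Finset.mem_product, Finset.mem_filter, Finset.mem_compl] at h h' e
    have hy : y = rotateWord (-j + i) x := by
      rw [← rotateWord_rotateWord, e, rotateWord_rotateWord]; simp
    have hx : x = rotateWord (-i + j) y := by
      rw [← rotateWord_rotateWord, ← e, rotateWord_rotateWord]; simp
    have hxy : x = y := rk.injective <| le_antisymm
      ((h.2.2 (-j + i)).trans_eq (by rw [← hy])) ((h'.2.2 (-i + j)).trans_eq (by rw [← hx]))
    subst hxy
    by_cases hij : -j + i = 0
    · rw [neg_add_eq_zero] at hij; rw [hij]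
    · exact absurd ((hC _).mpr (exists_eq_const_of_rotateWord_eq hij hy.symm)) h.2.1
  · intro x hx
    obtain ⟨i, hi⟩ := Finite.exists_min fun i ↦ rk (rotateWord i x)
    refine ⟨(-i, rotateWord i x), ?_, by simp [rotateWord_rotateWord]⟩
    simp only [Finset.mem_product, Finset.mem_filter, Finset.mem_compl, Finset.mem_univ,
      true_and] at hx ⊢
    exact ⟨fun h ↦ hx (hCr h), fun j ↦ by rw [rotateWord_rotateWord]; exact hi _⟩

end Rotation

section Tate

variable {p : ℕ} {ι κ : Type*} [Fintype ι] [DecidableEq ι] [Fintype κ] [DecidableEq κ]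
  {K L : Type*} [Field K] [Field L]

/-- The norm element `1 + G + ⋯ + G ^ (p - 1)`. -/
def Matrix.cyclicNorm (p : ℕ) (G : Matrix ι ι K) : Matrix ι ι K :=
  ∑ i : Fin p, G ^ (i : ℕ)

/-- The zeroth Tate cohomology of the cyclic group of order `p` acting through `G`. -/
abbrev Matrix.TateZero (p : ℕ) (G : Matrix ι ι K) : Type _ :=
  LinearMap.ker (G - 1).mulVecLin ⧸
    (LinearMap.range (G.cyclicNorm p).mulVecLin).submoduleOf (LinearMap.ker (G - 1).mulVecLin)

namespace Matrix

theorem mem_ker_sub_one {G : Matrix ι ι K} {v : ι → K} :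
    v ∈ LinearMap.ker (G - 1).mulVecLin ↔ G *ᵥ v = v := by
  simp [sub_eq_zero]

theorem pow_mulVec_of_mulVec_eq {G : Matrix ι ι K} {v : ι → K} (h : G *ᵥ v = v) (n : ℕ) :
    (G ^ n) *ᵥ v = v := by
  induction n with
  | zero => simp
  | succ n ih => rw [pow_succ, ← mulVec_mulVec, h, ih]

theorem pow_val_add [NeZero p] {G : Matrix ι ι K} (hG : G ^ p = 1) (i j : Fin p) :
    G ^ ((i + j : Fin p) : ℕ) = G ^ (i : ℕ) * G ^ (j : ℕ) := by
  rw [Fin.val_add, ← pow_add, ← pow_eq_pow_mod _ hG]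

theorem sub_one_mul_cyclicNorm {G : Matrix ι ι K} (hG : G ^ p = 1) :
    (G - 1) * G.cyclicNorm p = 0 := by
  rw [cyclicNorm, Fin.sum_univ_eq_sum_range, mul_geom_sum, hG, sub_self]

theorem range_cyclicNorm_le {G : Matrix ι ι K} (hG : G ^ p = 1) :
    LinearMap.range (G.cyclicNorm p).mulVecLin ≤ LinearMap.ker (G - 1).mulVecLin := by
  rintro _ ⟨v, rfl⟩
  rw [LinearMap.mem_ker, mulVecLin_apply, mulVecLin_apply, mulVec_mulVec,
    sub_one_mul_cyclicNorm hG, zero_mulVec]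

theorem finrank_tateZero {G : Matrix ι ι K} (hG : G ^ p = 1) :
    Module.finrank K (G.TateZero p) + (G.cyclicNorm p).rank + (G - 1).rank = Fintype.card ι := by
  have h := Submodule.finrank_quotient_add_finrank
    ((LinearMap.range (G.cyclicNorm p).mulVecLin).submoduleOf (LinearMap.ker (G - 1).mulVecLin))
  rw [(Submodule.submoduleOfEquivOfLe (range_cyclicNorm_le hG)).finrank_eq] at h
  have h' := (G - 1).mulVecLin.finrank_range_add_finrank_ker
  rw [Module.finrank_fintype_fun_eq_card] at h'
  rw [Matrix.rank, Matrix.rank]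
  lia

theorem map_cyclicNorm (f : K →+* L) (G : Matrix ι ι K) :
    (G.cyclicNorm p).map f = (G.map f).cyclicNorm p := by
  simp only [cyclicNorm, ← RingHom.mapMatrix_apply, map_sum, map_pow]

theorem rank_map_ringHom (f : K →+* L) (A : Matrix ι ι K) : (A.map f).rank = A.rank := by
  classical
  obtain ⟨t, t', d, h⟩ := Pivot.exists_list_transvec_mul_diagonal_mul_list_transvec A
  have hu (t : List (TransvectionStruct ι K)) :
      IsUnit (t.map TransvectionStruct.toMatrix).prod.det :=
    by simp
  have hu' (t : List (TransvectionStruct ι K)) :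
      IsUnit (((t.map TransvectionStruct.toMatrix).prod).map f).det := by
    rw [← RingHom.mapMatrix_apply, ← RingHom.map_det]
    exact (hu t).map f
  rw [h, Matrix.map_mul, Matrix.map_mul, rank_mul_eq_left_of_isUnit_det _ _ (hu' t'),
    rank_mul_eq_right_of_isUnit_det _ _ (hu' t), rank_mul_eq_left_of_isUnit_det _ _ (hu t'),
    rank_mul_eq_right_of_isUnit_det _ _ (hu t), diagonal_map (map_zero f), rank_diagonal,
    rank_diagonal]
  exact Fintype.card_congr (Equiv.subtypeEquivRight fun i ↦ by simp)

omit [DecidableEq κ] in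
theorem rank_conj {S : Matrix ι κ K} {S' : Matrix κ ι K} (h : S * S' = 1) (A : Matrix ι ι K) :
    (S' * A * S).rank = A.rank := by
  refine le_antisymm ((rank_mul_le_left _ _).trans (rank_mul_le_right _ _)) ?_
  calc A.rank = (S * (S' * A * S) * S').rank := by
        rw [Matrix.mul_assoc S, Matrix.mul_assoc (S' * A), h, Matrix.mul_one, ← Matrix.mul_assoc, h,
          Matrix.one_mul]
    _ ≤ _ := (rank_mul_le_left _ _).trans (rank_mul_le_right _ _)

theorem conj_pow {S : Matrix ι κ K} {S' : Matrix κ ι K} (h : S * S' = 1) (h' : S' * S = 1)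
    (A : Matrix ι ι K) (n : ℕ) : (S' * A * S) ^ n = S' * A ^ n * S := by
  induction n with
  | zero => simp [h']
  | succ n ih =>
    rw [pow_succ, ih, pow_succ]
    simp only [Matrix.mul_assoc]
    rw [← Matrix.mul_assoc S S', h, Matrix.one_mul]

theorem cyclicNorm_conj {S : Matrix ι κ K} {S' : Matrix κ ι K} (h : S * S' = 1) (h' : S' * S = 1)
    (A : Matrix ι ι K) : (S' * A * S).cyclicNorm p = S' * A.cyclicNorm p * S := by
  simp_rw [cyclicNorm, conj_pow h h', Matrix.mul_sum, Matrix.sum_mul]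

section Words

variable [NeZero p] {X : Type*} [Fintype X] [DecidableEq X]

variable (p X K) in
/-- The matrix through which rotation acts on functions on words. -/
def wordRotation : Matrix (Fin p → X) (Fin p → X) K :=
  Equiv.Perm.permMatrix K (rotateWord 1)

theorem wordRotation_mulVec (v : (Fin p → X) → K) :
    wordRotation p K X *ᵥ v = v ∘ rotateWord 1 :=
  permMatrix_mulVec _

open Fin.NatCast in
theorem wordRotation_pow_mulVec (n : ℕ) (v : (Fin p → X) → K) :
    wordRotation p K X ^ n *ᵥ v = v ∘ rotateWord (n : Fin p) := by
  induction n with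
  | zero => ext; simp
  | succ n ih =>
    ext x
    rw [pow_succ', ← mulVec_mulVec, ih, wordRotation_mulVec]
    simp [rotateWord_rotateWord]

theorem wordRotation_pow : wordRotation p K X ^ p = 1 := by
  refine ext_of_mulVec_single fun x ↦ ?_
  rw [wordRotation_pow_mulVec]
  ext; simp [Pi.single_apply, one_apply]

theorem cyclicNorm_wordRotation_mulVec (v : (Fin p → X) → K) :
    (wordRotation p K X).cyclicNorm p *ᵥ v = fun x ↦ ∑ i : Fin p, v (rotateWord i x) := by
  ext x
  simp [cyclicNorm, sum_mulVec, wordRotation_pow_mulVec]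

theorem finrank_tateZero_wordRotation [Fact p.Prime] [CharP K p] :
    Module.finrank K ((wordRotation p K X).TateZero p) = Fintype.card X := by
  let r : LinearMap.ker (wordRotation p K X - 1).mulVecLin →ₗ[K] X → K :=
    LinearMap.funLeft K K (fun a (_ : Fin p) ↦ a) ∘ₗ Submodule.subtype _
  have hr : Function.Surjective r := fun w ↦ by
    let v : (Fin p → X) → K := Function.extend (fun a (_ : Fin p) ↦ a) w 0
    have hinj : Function.Injective (fun (a : X) (_ : Fin p) ↦ a) := fun a b h ↦ congr_fun h 0
    refine ⟨⟨v, mem_ker_sub_one.mpr ?_⟩, funext fun a ↦ hinj.extend_apply w 0 a⟩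
    rw [wordRotation_mulVec]
    ext x
    by_cases hx : ∃ a, (fun _ ↦ a) = x
    · obtain ⟨a, rfl⟩ := hx; simp
    · have hx' : ¬ ∃ a, (fun _ ↦ a) = rotateWord 1 x := fun ⟨a, ha⟩ ↦
        hx ⟨a, (rotateWord 1).injective (by simpa using ha)⟩
      simp [v, Function.extend_apply' _ _ _ hx, Function.extend_apply' _ _ _ hx']
  have hker : LinearMap.ker r = (LinearMap.range ((wordRotation p K X).cyclicNorm p).mulVecLin
      ).submoduleOf (LinearMap.ker (wordRotation p K X - 1).mulVecLin) := by
    ext ⟨v, hv⟩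
    rw [mem_ker_sub_one] at hv
    rw [LinearMap.mem_ker, Submodule.submoduleOf, Submodule.mem_comap, LinearMap.mem_range,
      Submodule.subtype_apply]
    simp only [mulVecLin_apply]
    constructor
    · intro h
      obtain ⟨T, hT⟩ := exists_sum_words_eq (p := p) X ((Fin p → X) → K)
      have hvr (i : Fin p) (x) : v (rotateWord i x) = v x := by
        have := congr_fun (pow_mulVec_of_mulVec_eq hv i) x
        rwa [wordRotation_pow_mulVec, Function.comp_apply, Fin.cast_val_eq_self] at this
      refine ⟨∑ x ∈ T, Pi.single x (v x), ?_⟩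
      have hsum := hT fun x ↦ Pi.single x (v x)
      rw [Finset.univ_sum_single, Finset.sum_eq_zero (fun a _ ↦ ?_), zero_add] at hsum
      · rw [cyclicNorm_wordRotation_mulVec]
        refine Eq.trans ?_ hsum.symm
        rw [← Equiv.sum_comp (Equiv.neg _)]
        ext y
        simp only [Finset.sum_apply, hvr, Equiv.neg_apply]
        refine Finset.sum_congr rfl fun i _ ↦ Finset.sum_congr rfl fun x _ ↦ ?_
        have : rotateWord i y = x ↔ y = rotateWord (-i) x := by
          constructor <;> rintro rfl <;> simp [rotateWord_rotateWord]
        simp only [Pi.single_apply, this]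
      · have : v (fun _ ↦ a) = 0 := congr_fun h a
        simp [this]
    · rintro ⟨w, rfl⟩
      ext a
      simp [r, LinearMap.funLeft_apply, cyclicNorm_wordRotation_mulVec, CharP.cast_eq_zero]
  unfold TateZero
  rw [← hker, (r.quotKerEquivOfSurjective hr).finrank_eq,
    Module.finrank_fintype_fun_eq_card]

end Words

section Frobenius

variable [Fact p.Prime] [NeZero p] {D : Type*} [Ring D] [Algebra K D]

open Fin.NatCast in
theorem tateZero_action_aux (ρ : MultilinearMap K (fun _ : Fin p ↦ D) (Matrix ι ι K))
    {G : Matrix ι ι K} (hG : G ^ p = 1) (hρG : ∀ d, G * ρ (rotateWord 1 d) = ρ d * G)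
    (x y : D) {v : ι → K} (hv : G *ᵥ v = v) :
    ρ (fun _ ↦ x + y) *ᵥ v - (ρ (fun _ ↦ x) *ᵥ v + ρ (fun _ ↦ y) *ᵥ v) ∈
      LinearMap.range (G.cyclicNorm p).mulVecLin := by
  obtain ⟨T, hT⟩ := exists_sum_words_eq (p := p) (Fin 2) (ι → K)
  have hρGn (n : ℕ) (d : Fin p → D) :
      G ^ n * ρ ((rotateWord 1)^[n] d) = ρ d * G ^ n := by
    induction n generalizing d with
    | zero => simp
    | succ n ih =>
      rw [Function.iterate_succ_apply, pow_succ', Matrix.mul_assoc, ih, ← Matrix.mul_assoc, hρG,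
        Matrix.mul_assoc]
  have hit (i : Fin p) (d : Fin p → D) : (rotateWord 1)^[(i : ℕ)] d = rotateWord i d := by
    ext j
    have (n : ℕ) (d : Fin p → D) : (rotateWord 1)^[n] d = rotateWord (n : Fin p) d := by
      induction n generalizing d with
      | zero => simp
      | succ n ih => rw [Function.iterate_succ_apply, ih, rotateWord_rotateWord, Nat.cast_succ]
    rw [this, Fin.cast_val_eq_self]
  have hrot (i : Fin p) (d : Fin p → D) :
      ρ (rotateWord i d) *ᵥ v = G ^ ((-i : Fin p) : ℕ) *ᵥ (ρ d *ᵥ v) := by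
    conv_rhs => rw [← pow_mulVec_of_mulVec_eq hv i]
    rw [mulVec_mulVec _ (ρ d), ← hρGn, hit, mulVec_mulVec, ← Matrix.mul_assoc, ← pow_val_add hG]
    simp
  let g : Fin 2 → D := ![x, y]
  have hword (i : Fin p) (r : Fin p → Fin 2) :
      (fun j ↦ g (rotateWord i r j)) = rotateWord i fun j ↦ g (r j) := by
    ext j; simp [rotateWord_apply]
  have hexp := congr($(ρ.map_sum fun _ ↦ g) *ᵥ v)
  rw [sum_mulVec, hT] at hexp
  simp only [Fin.sum_univ_two, g, cons_val_zero, cons_val_one] at hexp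
  refine ⟨∑ r ∈ T, ρ (fun i ↦ g (r i)) *ᵥ v, ?_⟩
  rw [hexp, add_sub_cancel_left, mulVecLin_apply, cyclicNorm, sum_mulVec,
    ← Equiv.sum_comp (Equiv.neg _)]
  refine Finset.sum_congr rfl fun i _ ↦ ?_
  rw [mulVec_sum]
  refine Finset.sum_congr rfl fun r _ ↦ ?_
  rw [Equiv.neg_apply, ← hrot, ← hword]

/-- An algebra with a multiplicative representation of its `p`-th tensor power, together with a
compatible action of the cyclic group of order `p`, acts Frobenius-semilinearly on the zeroth Tate
cohomology. -/
theorem exists_ringHom_end_tateZero (ρ : MultilinearMap K (fun _ : Fin p ↦ D) (Matrix ι ι K))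
    (hρ1 : ρ 1 = 1) (hρmul : ∀ d e, ρ (d * e) = ρ d * ρ e)
    {G : Matrix ι ι K} (hG : G ^ p = 1) (hρG : ∀ d, G * ρ (rotateWord 1 d) = ρ d * G) :
    ∃ R : D →+* Module.End K (G.TateZero p),
      ∀ c : K, R (algebraMap K D c) = algebraMap K _ (c ^ p) := by
  have hcomm (d : D) : Commute G (ρ fun _ ↦ d) := by
    show _ = _
    simpa using hρG fun _ ↦ d
  have hker (d : D) (v : ι → K) (hv : v ∈ LinearMap.ker (G - 1).mulVecLin) :
      (ρ fun _ ↦ d).mulVecLin v ∈ LinearMap.ker (G - 1).mulVecLin := by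
    rw [mem_ker_sub_one] at hv ⊢
    rw [mulVecLin_apply, mulVec_mulVec, (hcomm d).eq, ← mulVec_mulVec, hv]
  have hrange (d : D) : (LinearMap.range (G.cyclicNorm p).mulVecLin).submoduleOf
        (LinearMap.ker (G - 1).mulVecLin) ≤
      ((LinearMap.range (G.cyclicNorm p).mulVecLin).submoduleOf
        (LinearMap.ker (G - 1).mulVecLin)).comap
        ((ρ fun _ ↦ d).mulVecLin.restrict (hker d)) := by
    rintro ⟨_, hv⟩ ⟨w, rfl⟩
    refine ⟨(ρ fun _ ↦ d) *ᵥ w, ?_⟩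
    have : Commute (G.cyclicNorm p) (ρ fun _ ↦ d) :=
      Commute.sum_left _ _ _ fun i _ ↦ (hcomm d).pow_left _
    simp [LinearMap.restrict_apply, mulVec_mulVec, this.eq]
  let A (d : D) : Module.End K (G.TateZero p) := Submodule.mapQ _ _ _ (hrange d)
  have hA {d : D} {f : Module.End K (G.TateZero p)} (h : ∀ v hv, f (Submodule.Quotient.mk ⟨v, hv⟩) =
      Submodule.Quotient.mk ⟨(ρ fun _ ↦ d) *ᵥ v, hker d v hv⟩) : A d = f :=
    Submodule.linearMap_qext _ (LinearMap.ext fun ⟨v, hv⟩ ↦ (h v hv).symm)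
  have hsmul (c : K) : (ρ fun _ ↦ algebraMap K D c) = c ^ p • 1 := by
    simpa [← Algebra.algebraMap_eq_smul_one, ← Pi.one_def, hρ1] using
      ρ.map_smul_univ (fun _ ↦ c) (fun _ ↦ 1)
  refine ⟨{
    toFun := A
    map_one' := hA fun v hv ↦ ?_
    map_mul' := fun x y ↦ hA fun v hv ↦ ?_
    map_zero' := hA fun v hv ↦ ?_
    map_add' := fun x y ↦ hA fun v hv ↦ ?_ }, fun c ↦ hA fun v hv ↦ ?_⟩
  · refine congr_arg Submodule.Quotient.mk (Subtype.ext ?_)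
    change v = ρ 1 *ᵥ v
    rw [hρ1, one_mulVec]
  · refine congr_arg Submodule.Quotient.mk (Subtype.ext ?_)
    exact (mulVec_mulVec _ _ _).trans congr($((hρmul _ _).symm) *ᵥ v)
  · refine congr_arg Submodule.Quotient.mk (Subtype.ext ?_)
    simp [ρ.map_coord_zero 0]
  · refine ((Submodule.Quotient.eq _).mpr ?_).symm
    exact tateZero_action_aux ρ hG hρG x y (mem_ker_sub_one.mp hv)
  · refine congr_arg Submodule.Quotient.mk (Subtype.ext ?_)
    simp [hsmul, smul_mulVec]

end Frobenius

end Matrix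

end Tate

namespace Matrix

theorem exists_conj_of_algHom {k L ι X : Type*} [Field k] [Field L] [Algebra k L]
    [Fintype ι] [DecidableEq ι] [Fintype X] [DecidableEq X] [Nonempty X]
    (hcard : Fintype.card X = Fintype.card ι) (f : Matrix ι ι k →ₐ[k] Matrix X X L) :
    ∃ (S : Matrix X ι L) (S' : Matrix ι X L), S * S' = 1 ∧ S' * S = 1 ∧
      ∀ a, f a = S * a.map (algebraMap k L) * S' := by
  obtain ⟨i₀, hi₀⟩ : ∃ i, f (single i i 1) ≠ 0 := by
    by_contra! h
    have := map_sum f (fun i ↦ single i i (1 : k)) Finset.univ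
    rw [sum_single_one, map_one, Finset.sum_eq_zero fun i _ ↦ h i] at this
    exact one_ne_zero this
  obtain ⟨x₀, y₀, hxy⟩ : ∃ x y, f (single i₀ i₀ 1) x y ≠ 0 := by
    by_contra! h
    exact hi₀ (ext h)
  set c := f (single i₀ i₀ 1) x₀ y₀ with hc
  let S : Matrix X ι L := of fun x j ↦ f (single j i₀ 1) x y₀
  let S' : Matrix ι X L := of fun j x ↦ c⁻¹ * f (single i₀ j 1) x₀ x
  have hS : S' * S = 1 := by
    ext j l
    have : (S' * S) j l = c⁻¹ * f (single i₀ j 1 * single l i₀ 1) x₀ y₀ := by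
      rw [map_mul]
      simp [S, S', mul_apply, Finset.mul_sum, mul_assoc]
    rw [this, one_apply]
    split_ifs with h
    · subst h
      rw [single_mul_single_same, mul_one, ← hc, inv_mul_cancel₀ hxy]
    · simp [single_mul_single_of_ne _ _ _ _ h]
  have hS' : S * S' = 1 := (mul_eq_one_comm_of_card_eq _ _ _ hcard.symm).mp hS
  refine ⟨S, S', hS', hS, fun a ↦ ?_⟩
  have h : f a * S = S * a.map (algebraMap k L) := by
    ext x j
    have h₁ : (f a * S) x j = f (a * single j i₀ 1) x y₀ := by
      rw [map_mul]; simp [S, mul_apply]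
    have h₂ : a * single j i₀ 1 = ∑ i, a i j • single i i₀ 1 := by
      ext i l
      by_cases hl : l = i₀
      · subst hl; simp [Matrix.sum_apply, single_apply]
      · simp [Matrix.sum_apply, mul_apply, Ne.symm hl]
    simp_rw [h₁, h₂, map_sum, map_smul, Matrix.sum_apply, Matrix.smul_apply, Algebra.smul_def]
    simp [S, mul_apply, mul_comm]
  rw [← h, Matrix.mul_assoc, hS', Matrix.mul_one]

end Matrix

section Goldman

variable {p : ℕ} {k L D : Type*} [Field k] [Field L] [Algebra k L] [Ring D] [Algebra k D]

variable (p k D) in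
/-- The cyclic rotation of the tensor factors. -/
noncomputable def rotateTensor [NeZero p] :
    (⨂[k] (_ : Fin p), D) →ₐ[k] (⨂[k] (_ : Fin p), D) :=
  PiTensorProduct.liftAlgHom ((PiTensorProduct.tprod k).domDomCongr (Equiv.addRight 1)) rfl
    fun _ _ ↦ (PiTensorProduct.tprod_mul_tprod _ _).symm

theorem rotateTensor_tprod [NeZero p] (d : Fin p → D) :
    rotateTensor p k D (PiTensorProduct.tprod k d) = PiTensorProduct.tprod k (rotateWord 1 d) := by
  refine (PiTensorProduct.lift.tprod d).trans ?_
  rw [MultilinearMap.domDomCongr_apply]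
  rfl

variable {n : Type*} [Fintype n] [DecidableEq n]

/-- The Kronecker product of matrices, as a multilinear map. -/
def Matrix.kroneckerMultilinear (ψ : D →ₐ[k] Matrix n n L) :
    MultilinearMap k (fun _ : Fin p ↦ D) (Matrix (Fin p → n) (Fin p → n) L) :=
  (Matrix.ofLinearEquiv k).toLinearMap.compMultilinearMap <| MultilinearMap.pi fun a ↦
    MultilinearMap.pi fun b ↦ (MultilinearMap.mkPiAlgebra k (Fin p) L).compLinearMap fun i ↦
      Matrix.entryLinearMap k L (a i) (b i) ∘ₗ ψ.toLinearMap

theorem Matrix.kroneckerMultilinear_apply (ψ : D →ₐ[k] Matrix n n L) (d : Fin p → D)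
    (a b : Fin p → n) : kroneckerMultilinear ψ d a b = ∏ i, ψ (d i) (a i) (b i) := by
  simp [kroneckerMultilinear]

/-- The Kronecker product of matrices, as an algebra homomorphism. -/
noncomputable def Matrix.kroneckerAlgHom (ψ : D →ₐ[k] Matrix n n L) :
    (⨂[k] (_ : Fin p), D) →ₐ[k] Matrix (Fin p → n) (Fin p → n) L :=
  PiTensorProduct.liftAlgHom (kroneckerMultilinear ψ)
    (by
      ext a b
      simp [kroneckerMultilinear_apply, one_apply, Fintype.prod_ite_zero, funext_iff])
    (fun d e ↦ by
      ext a b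
      simp_rw [mul_apply, kroneckerMultilinear_apply, Pi.mul_apply, map_mul, mul_apply,
        Finset.prod_univ_sum, Fintype.piFinset_univ, Finset.prod_mul_distrib])

theorem Matrix.wordRotation_mul_kroneckerAlgHom [NeZero p] (ψ : D →ₐ[k] Matrix n n L)
    (x : ⨂[k] (_ : Fin p), D) :
    wordRotation p L n * kroneckerAlgHom ψ (rotateTensor p k D x) =
      kroneckerAlgHom ψ x * wordRotation p L n := by
  induction x using PiTensorProduct.induction_on with
  | add x y hx hy => simp only [map_add, mul_add, add_mul, hx, hy]
  | smul_tprod c d =>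
    simp only [map_smul, mul_smul_comm, smul_mul_assoc, rotateTensor_tprod]
    congr 1
    refine ext_of_mulVec_single fun x ↦ ?_
    rw [← mulVec_mulVec, ← mulVec_mulVec, wordRotation_mulVec, wordRotation_mulVec]
    ext a
    simp only [Function.comp_apply, mulVec, dotProduct]
    rw [← Equiv.sum_comp (rotateWord 1)]
    refine Finset.sum_congr rfl fun b _ ↦ ?_
    congr 1
    simp only [kroneckerAlgHom, PiTensorProduct.liftAlgHom_apply, PiTensorProduct.lift.tprod,
      kroneckerMultilinear_apply, rotateWord_apply]
    exact Equiv.prod_comp (Equiv.addRight 1) fun i ↦ ψ (d i) (a i) (b i)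

theorem Matrix.finrank_tateZero_eq_of_map_eq_conj {ι κ : Type*} [Fintype ι] [DecidableEq ι]
    [Fintype κ] [DecidableEq κ] {G : Matrix ι ι k} {P : Matrix κ κ L} {S : Matrix κ ι L}
    {S' : Matrix ι κ L} (h : S * S' = 1) (h' : S' * S = 1) (hG : G ^ p = 1) (hP : P ^ p = 1)
    (hcard : Fintype.card κ = Fintype.card ι) (hGP : G.map (algebraMap k L) = S' * P * S) :
    Module.finrank k (G.TateZero p) = Module.finrank L (P.TateZero p) := by
  have h₁ := finrank_tateZero hG
  have h₂ := finrank_tateZero hP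
  have h₃ : (G.cyclicNorm p).rank = (P.cyclicNorm p).rank := by
    rw [← rank_map_ringHom (algebraMap k L), map_cyclicNorm, hGP, cyclicNorm_conj h h', rank_conj h]
  have h₄ : (G - 1).rank = (P - 1).rank := by
    have : (G - 1).map (algebraMap k L) = S' * (P - 1) * S := by
      rw [Matrix.map_sub _ (map_sub _), hGP, Matrix.map_one _ (map_zero _) (map_one _),
        Matrix.mul_sub, Matrix.sub_mul, Matrix.mul_one, h']
    rw [← rank_map_ringHom (algebraMap k L), this, rank_conj h]
  lia

theorem mem_range_algebraMap_of_pow_mem_of_isSeparable [Algebra.IsSeparable k L] [Fact p.Prime]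
    [CharP k p] {x : L} (hx : x ^ p ∈ (algebraMap k L).range) : x ∈ (algebraMap k L).range := by
  have : ExpChar k p := .prime Fact.out
  have : x ∈ perfectClosure k L := (mem_perfectClosure_iff_pow_mem p).mpr ⟨1, by simpa using hx⟩
  rwa [perfectClosure.eq_bot_of_isSeparable] at this

/-- If the `p`-th tensor power of `D` is a matrix algebra, then the rotation of the tensor factors
is implemented by a matrix of order dividing `p`, which becomes conjugate to the rotation of words
after a separable splitting field of `D`. -/
theorem exists_matrix_rotateTensor [Fact p.Prime] [CharP k p] [Algebra.IsSeparable k L]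
    [Nonempty n] {ι : Type*} [Fintype ι] [DecidableEq ι]
    (e : (⨂[k] (_ : Fin p), D) ≃ₐ[k] Matrix ι ι k) (ψ : D →ₐ[k] Matrix n n L)
    (hcard : Fintype.card (Fin p → n) = Fintype.card ι) :
    ∃ G : Matrix ι ι k, G ^ p = 1 ∧ (∀ x, G * e (rotateTensor p k D x) = e x * G) ∧
      Module.finrank k (G.TateZero p) = Fintype.card n := by
  have : Nonempty ι := Fintype.card_pos_iff.mp (hcard ▸ Fintype.card_pos)
  have := charP_of_injective_algebraMap (algebraMap k L).injective p
  obtain ⟨H', H, hH', hH, hrot⟩ := Matrix.exists_conj_of_algHom rfl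
    (e.toAlgHom.comp ((rotateTensor p k D).comp e.symm.toAlgHom))
  replace hrot (x) : e (rotateTensor p k D x) = H' * e x * H := by simpa using hrot (e x)
  obtain ⟨S, S', hS, hS', hψ⟩ := Matrix.exists_conj_of_algHom hcard
    ((Matrix.kroneckerAlgHom ψ).comp e.symm.toAlgHom)
  replace hψ (x) : Matrix.kroneckerAlgHom ψ x = S * (e x).map (algebraMap k L) * S' := by
    simpa using hψ (e x)
  set P := Matrix.wordRotation p L n
  have hPp : P ^ p = 1 := Matrix.wordRotation_pow
  set f := (algebraMap k L).mapMatrix (m := ι) with hf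
  set Q := S' * P * S with hQ
  have hQp : Q ^ p = 1 := by rw [hQ, Matrix.conj_pow hS hS', hPp, Matrix.mul_one, hS']
  have hQe (x) : Q * f (e (rotateTensor p k D x)) = f (e x) * Q := by
    have h := congr(S' * $(Matrix.wordRotation_mul_kroneckerAlgHom ψ x) * S)
    simp only [hψ, Matrix.mul_assoc, hS', Matrix.mul_one] at h
    simp only [← Matrix.mul_assoc, hS', Matrix.one_mul] at h
    simpa only [hQ, hf, RingHom.mapMatrix_apply, ← Matrix.mul_assoc] using h
  have hcomm (x) : Commute (f (e x)) (Q * f H') := by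
    have h₁ := hQe x
    rw [hrot, map_mul, map_mul] at h₁
    have h₂ := congr($h₁ * f H')
    simp only [mul_assoc] at h₂
    rw [← map_mul f H H', hH, map_one, mul_one] at h₂
    exact h₂.symm.trans (mul_assoc _ _ _).symm
  obtain ⟨c, hc⟩ := Matrix.mem_range_scalar_iff_commute_single'.mpr fun i j ↦ by
    simpa [f] using hcomm (e.symm (Matrix.single i j 1))
  have hQH : Q = c • f H := by
    rw [Matrix.smul_eq_diagonal_mul, ← Matrix.scalar_apply, hc, ← RingHom.mapMatrix_apply, ← hf,
      mul_assoc, ← map_mul, hH', map_one, mul_one]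
  have hpow : (1 : Matrix ι ι L) = c ^ p • f (H ^ p) := by rw [← hQp, hQH, smul_pow, map_pow]
  obtain ⟨i⟩ := ‹Nonempty ι›
  have hci : c ^ p * algebraMap k L ((H ^ p) i i) = 1 := by
    simpa [f] using congr($hpow i i).symm
  obtain ⟨b, rfl⟩ : c ∈ (algebraMap k L).range :=
    mem_range_algebraMap_of_pow_mem_of_isSeparable
      ⟨((H ^ p) i i)⁻¹, by rw [map_inv₀, inv_eq_of_mul_eq_one_left hci]⟩
  have hmap : (b • H).map (algebraMap k L) = Q := by
    ext i j; rw [hQH]; simp [f, - algebraMap_smul]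
  have hG : (b • H) ^ p = 1 := by
    apply Matrix.map_injective (algebraMap k L).injective
    change f _ = _
    rw [map_pow, hf, RingHom.mapMatrix_apply, hmap, hQp]
    exact (Matrix.map_one _ (map_zero _) (map_one _)).symm
  refine ⟨b • H, hG, fun x ↦ ?_, ?_⟩
  · rw [hrot, smul_mul_assoc, mul_smul_comm, ← mul_assoc, ← mul_assoc, hH, one_mul]
  · rw [Matrix.finrank_tateZero_eq_of_map_eq_conj hS hS' hG hPp hcard hmap,
      Matrix.finrank_tateZero_wordRotation]

/-- If the Brauer class of `D` is annihilated by `p`, then `D` admits a representation, semilinear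
along the Frobenius endomorphism, whose dimension is the degree of `D`. -/
theorem exists_ringHom_matrix_of_piTensorProduct_algEquiv [Fact p.Prime] [CharP k p]
    [IsSimpleRing D] [Algebra.IsCentral k D] [FiniteDimensional k D] {ι : Type*} [Fintype ι]
    [DecidableEq ι] (e : (⨂[k] (_ : Fin p), D) ≃ₐ[k] Matrix ι ι k) :
    ∃ n, 0 < n ∧ n ^ 2 = Module.finrank k D ∧ ∃ R : D →+* Matrix (Fin n) (Fin n) k,
      ∀ c, R (algebraMap k D c) = algebraMap k _ (c ^ p) := by
  let L := SeparableClosure k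
  have := IsSimpleRing.baseChange (k := k) (D := D) L
  have := Algebra.IsCentral.baseChange (k := k) (D := D) L
  obtain ⟨n, hn, ⟨φ⟩⟩ :=
    IsSepClosed.exists_algEquiv_matrix_of_isCentral_of_isSimpleRing L (L ⊗[k] D)
  have hdim : n ^ 2 = Module.finrank k D := by
    rw [← Module.finrank_baseChange (R := L), φ.toLinearEquiv.finrank_eq, Module.finrank_matrix]
    simp [sq]
  have hcard : Fintype.card (Fin p → Fin n) = Fintype.card ι := by
    have h := e.toLinearEquiv.finrank_eq
    rw [Module.finrank_eq_card_basis (Basis.piTensorProduct fun _ ↦ Module.finBasis k D),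
      Module.finrank_matrix] at h
    simp only [Fintype.card_pi, Fintype.card_fin, Finset.prod_const, Finset.card_univ, ← hdim,
      Module.finrank_self, mul_one] at h ⊢
    rw [← pow_mul, mul_comm, pow_mul, ← sq] at h
    exact Nat.pow_left_injective two_ne_zero h
  obtain ⟨G, hG, hGe, hrank⟩ := exists_matrix_rotateTensor e
    ((φ.toAlgHom.restrictScalars k).comp Algebra.TensorProduct.includeRight) hcard
  obtain ⟨R, hR⟩ := Matrix.exists_ringHom_end_tateZero
    (e.toLinearMap.compMultilinearMap (PiTensorProduct.tprod k)) (map_one e)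
    (fun x y ↦ by
      simp [← PiTensorProduct.tprod_mul_tprod]) hG
    (fun d ↦ by simpa [rotateTensor_tprod] using hGe (PiTensorProduct.tprod k d))
  let b := Module.finBasisOfFinrankEq k _ (hrank.trans (Fintype.card_fin n))
  refine ⟨n, NeZero.pos n, hdim, (LinearMap.toMatrixAlgEquiv b).toRingHom.comp R, fun c ↦ ?_⟩
  simp [hR]

/-- If the Brauer class of `D` is annihilated by the characteristic `p`, then it is split by every
extension containing all `p`-th roots of elements of the base field. -/
theorem exists_algEquiv_matrix_of_piTensorProduct_algEquiv [Fact p.Prime] [CharP k p]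
    [IsSimpleRing D] [Algebra.IsCentral k D] [FiniteDimensional k D] {ι : Type*} [Fintype ι]
    [DecidableEq ι] (e : (⨂[k] (_ : Fin p), D) ≃ₐ[k] Matrix ι ι k)
    (hL : ∀ c : k, ∃ x : L, x ^ p = algebraMap k L c) :
    ∃ n, 0 < n ∧ Nonempty ((L ⊗[k] D) ≃ₐ[L] Matrix (Fin n) (Fin n) L) := by
  have := charP_of_injective_algebraMap (algebraMap k L).injective p
  obtain ⟨n, hn, hdim, R, hR⟩ := exists_ringHom_matrix_of_piTensorProduct_algEquiv e
  choose r hr using hL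
  have hinj : Function.Injective fun x : L ↦ x ^ p := frobenius_inj L p
  let r' : k →+* L :=
    { toFun := r
      map_one' := hinj (by simp [hr])
      map_mul' := fun x y ↦ hinj (by simp [hr, mul_pow])
      map_zero' := hinj (by simp [hr, (Fact.out : p.Prime).ne_zero])
      map_add' := fun x y ↦ hinj (by simp [hr, add_pow_char]) }
  have hr' (c : k) : r' (c ^ p) = algebraMap k L c := by rw [map_pow]; exact hr c
  let ψ : D →ₐ[k] Matrix (Fin n) (Fin n) L :=
    { r'.mapMatrix.comp R with
      commutes' := fun c ↦ by
        have : (algebraMap k (Matrix (Fin n) (Fin n) k) (c ^ p)).map r' =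
            algebraMap k (Matrix (Fin n) (Fin n) L) c := by
          ext i j
          simp only [Matrix.map_apply, Matrix.algebraMap_matrix_apply, Algebra.algebraMap_self_apply]
          split_ifs
          · exact hr' c
          · exact map_zero r'
        simpa [hR] using this }
  let Ψ : (L ⊗[k] D) →ₐ[L] Matrix (Fin n) (Fin n) L :=
    Algebra.TensorProduct.lift (Algebra.ofId L _) ψ fun x y ↦ Algebra.commutes _ _
  have := IsSimpleRing.baseChange (k := k) (D := D) L
  have : NeZero n := ⟨hn.ne'⟩
  have hΨ : Function.Injective Ψ := Ψ.toRingHom.injective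
  have hfin : Module.finrank L (L ⊗[k] D) = Module.finrank L (Matrix (Fin n) (Fin n) L) := by
    rw [Module.finrank_baseChange, ← hdim, Module.finrank_matrix]
    simp [sq]
  exact ⟨n, hn, ⟨.ofBijective Ψ ⟨hΨ,
    (LinearMap.injective_iff_surjective_of_finrank_eq_finrank (f := Ψ.toLinearMap) hfin).mp hΨ⟩⟩⟩

end Goldman

theorem exists_pow_eq_of_mem_adjoin_X_pow (p : ℕ) [Fact p.Prime] {c : RatFunc (ZMod p)}
    (hc : c ∈ IntermediateField.adjoin (ZMod p) {(RatFunc.X : RatFunc (ZMod p)) ^ p}) :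
    ∃ x : RatFunc (ZMod p), x ^ p = c := by
  have : CharP (RatFunc (ZMod p)) p :=
    charP_of_injective_algebraMap (algebraMap (ZMod p) _).injective p
  induction hc using IntermediateField.adjoin_induction with
  | mem x hx => exact ⟨_, hx.symm⟩
  | algebraMap x => exact ⟨algebraMap _ _ x, by rw [← map_pow, ZMod.pow_card]⟩
  | add x y _ _ hx hy =>
    obtain ⟨x, rfl⟩ := hx
    obtain ⟨y, rfl⟩ := hy
    exact ⟨x + y, add_pow_char _ _ _⟩
  | inv x _ hx =>
    obtain ⟨x, rfl⟩ := hx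
    exact ⟨x⁻¹, inv_pow _ _⟩
  | mul x y _ _ hx hy =>
    obtain ⟨x, rfl⟩ := hx
    obtain ⟨y, rfl⟩ := hy
    exact ⟨x * y, mul_pow _ _ _⟩
/-- Let `p` be a prime, `F = 𝔽_p(t)` and `k = 𝔽_p(tᵖ) ⊆ F` (a purely
inseparable extension of degree `p`).  Then the base-change map `Br(k) → Br(F)` kills the
`p`-torsion of `Br(k)`: if `D` is a finite-dimensional central simple `k`-algebra whose
Brauer class has order dividing `p` (i.e. `D^{⊗p}` is a matrix algebra over `k`), then
`D ⊗[k] F` is a matrix algebra over `F`, i.e. the image class is trivial. -/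
theorem statement17 (p : ℕ) [Fact p.Prime]
    (D : Type) [Ring D]
    [Algebra (IntermediateField.adjoin (ZMod p) {(RatFunc.X : RatFunc (ZMod p)) ^ p}) D]
    [FiniteDimensional
      (IntermediateField.adjoin (ZMod p) {(RatFunc.X : RatFunc (ZMod p)) ^ p}) D]
    (hsimple : IsSimpleRing D)
    (hcentral : Subalgebra.center
      (IntermediateField.adjoin (ZMod p) {(RatFunc.X : RatFunc (ZMod p)) ^ p}) D = ⊥)
    (hptors : ∃ m : ℕ, 0 < m ∧
      Nonempty ((⨂[IntermediateField.adjoin (ZMod p) {(RatFunc.X : RatFunc (ZMod p)) ^ p}]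
          (_ : Fin p), D) ≃ₐ[IntermediateField.adjoin (ZMod p)
            {(RatFunc.X : RatFunc (ZMod p)) ^ p}]
        Matrix (Fin m) (Fin m)
          (IntermediateField.adjoin (ZMod p) {(RatFunc.X : RatFunc (ZMod p)) ^ p}))) :
    ∃ r : ℕ, 0 < r ∧
      Nonempty ((RatFunc (ZMod p)
          ⊗[IntermediateField.adjoin (ZMod p) {(RatFunc.X : RatFunc (ZMod p)) ^ p}] D)
        ≃ₐ[RatFunc (ZMod p)] Matrix (Fin r) (Fin r) (RatFunc (ZMod p))) := by
  have : CharP (IntermediateField.adjoin (ZMod p) {(RatFunc.X : RatFunc (ZMod p)) ^ p}) p :=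
    charP_of_injective_algebraMap (algebraMap (ZMod p) _).injective p
  have : Algebra.IsCentral
      (IntermediateField.adjoin (ZMod p) {(RatFunc.X : RatFunc (ZMod p)) ^ p}) D := ⟨hcentral.le⟩
  obtain ⟨m, -, ⟨e⟩⟩ := hptors
  exact exists_algEquiv_matrix_of_piTensorProduct_algEquiv e
    fun c ↦ exists_pow_eq_of_mem_adjoin_X_pow p c.2
end
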